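/- Fix a binary tree B. Let X_{B,n} denote the number of occurrences of B as a fringe subtree in the left tree of a uniformly random tanglegram of size n. Then the expected value of X_{B,n} is asymptotically equal to μ_B·n as n → ∞, where μ_B = 2^{1−|B|}/|A(B)| and |B| is the number of leaves of B. In particular, for B a single cherry the mean number of cherries is asymptotically n/4. -/

import Mathlib

open scoped Classical

inductive PTree : Type
  | leaf : PTree
  | node : PTree → PTree → PTree
deriving DecidableEq

namespace PTree

def size : PTree → ℕ
  | leaf => 1
  | node l r => size l + size r

def cherries : PTree → ℕ
  | leaf => 0
  | node leaf leaf => 1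
  | node l r => cherries l + cherries r

def height : PTree → ℕ
  | leaf => 0
  | node l r => max (height l) (height r) + 1

def encode : PTree → ℕ
  | leaf => 0
  | node l r => Nat.pair (encode l) (encode r) + 1

def normalize : PTree → PTree
  | leaf => leaf
  | node l r =>
      let l' := normalize l
      let r' := normalize r
      if encode l' ≤ encode r' then node l' r' else node r' l'

def isoFuns : PTree → PTree → List (ℕ → ℕ)
  | leaf, leaf => [fun i => i]
  | node l r, node l' r' =>
      ((isoFuns l l').flatMap fun g => (isoFuns r r').map fun h =>
        fun i => if i < l.size then g i else h (i - l.size) + l'.size)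
      ++
      ((isoFuns l r').flatMap fun g => (isoFuns r l').map fun h =>
        fun i => if i < l.size then g i + l'.size else h (i - l.size))
  | _, _ => []

def planeTrees : ℕ → Finset PTree
  | 0 => ∅
  | 1 => {leaf}
  | n + 2 =>
      (Finset.range (n + 1)).attach.biUnion fun k =>
        ((planeTrees (k.1 + 1)) ×ˢ (planeTrees (n + 1 - k.1))).image
          fun p => node p.1 p.2
  termination_by n => n
  decreasing_by
  · have := Finset.mem_range.mp k.2; omega
  · omega

def binTrees (n : ℕ) : Finset PTree := (planeTrees n).image normalize

/-- Triples (T, v, S): left plane tree, right plane tree, and a matching `v`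
(a permutation of `0, …, n-1`, encoded as the list of its values) matching
leaf `i` of `T` with leaf `v i` of `S`. -/
def Triples (n : ℕ) : Finset (PTree × PTree × List ℕ) :=
  (planeTrees n) ×ˢ ((planeTrees n) ×ˢ (List.range n).permutations.toFinset)

/-- Two triples represent the same tanglegram iff there are isomorphisms of the left
trees and of the right trees compatible with the matchings. -/
def equivTriple (n : ℕ) (t t' : PTree × PTree × List ℕ) : Bool :=
  (isoFuns t.1 t'.1).any fun φ => (isoFuns t.2.1 t'.2.1).any fun ψ =>
    (List.range n).all fun i => t'.2.2.getD (φ i) 0 == ψ (t.2.2.getD i 0)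

/-- The tanglegrams of size `n`: equivalence classes of triples. -/
def tangleClasses (n : ℕ) : Finset (Finset (PTree × PTree × List ℕ)) :=
  (Triples n).image fun t => (Triples n).filter (fun t' => equivTriple n t t' = true)

/-- The number of tanglegrams of size `n`. -/
def numTanglegrams (n : ℕ) : ℕ := (tangleClasses n).card

/-- The probability that a uniformly random tanglegram of size `n` satisfies the
(isomorphism-invariant) property `P` of triples. -/
noncomputable def tangleProb (n : ℕ) (P : PTree × PTree × List ℕ → Prop) : ℝ :=
  ((tangleClasses n).filter fun c => ∃ t ∈ c, P t).card / numTanglegrams n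

/-- The expectation of the statistic `f` of a uniformly random tanglegram of size `n`. -/
noncomputable def tangleExp (n : ℕ) (f : PTree × PTree × List ℕ → ℕ) : ℝ :=
  ∑' k : ℕ, (k : ℝ) * tangleProb n (fun t => f t = k)

end PTree

namespace PTree

/-- The distribution on pairs of binary trees (canonical representatives) induced by
the two halves of a uniformly random tanglegram of size `n`:
probability that the pair of isomorphism classes of the two trees lies in `S`. -/
noncomputable def nuT (n : ℕ) (S : Finset (PTree × PTree)) : ℝ :=
  tangleProb n fun t => (normalize t.1, normalize t.2.1) ∈ S

/-- The distribution on pairs of binary trees induced by two independent uniformly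
random plane binary trees with `n` leaves. -/
noncomputable def nuP (n : ℕ) (S : Finset (PTree × PTree)) : ℝ :=
  (((planeTrees n) ×ˢ (planeTrees n)).filter
      fun p => (normalize p.1, normalize p.2) ∈ S).card / ((planeTrees n).card ^ 2 : ℝ)

/-- The total variation distance between `nuT` and `nuP`. -/
noncomputable def tvDist (n : ℕ) : ℝ :=
  ((binTrees n ×ˢ binTrees n).powerset).sup' (Finset.powerset_nonempty _)
    fun S => |nuT n S - nuP n S|

/-- The number of occurrences of (trees isomorphic to) `B` as a fringe subtree of `T`. -/
def occ (B : PTree) : PTree → ℕ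
  | leaf => if normalize leaf = normalize B then 1 else 0
  | node l r => (if normalize (node l r) = normalize B then 1 else 0) + occ B l + occ B r

/-- The number of generators of the automorphism group of `T`: the number of internal
vertices whose two branches are isomorphic. -/
def gens : PTree → ℕ
  | leaf => 0
  | node l r => (if normalize l = normalize r then 1 else 0) + gens l + gens r

/-- `T` has a root branch isomorphic to `B`. -/
def hasBranch (B : PTree) : PTree → Prop
  | leaf => False
  | node l r => normalize l = normalize B ∨ normalize r = normalize B

/-- The cherries of a plane binary tree whose leaves are numbered from `k` on
(left to right), as pairs of leaf positions. -/
def cherryList : PTree → ℕ → List (ℕ × ℕ)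
  | leaf, _ => []
  | node leaf leaf, k => [(k, k + 1)]
  | node l r, k => cherryList l k ++ cherryList r (k + l.size)

/-- The number of matched cherries: cherries of `T` whose two leaves are matched by `L`
to the two leaves of a cherry of `S`. -/
def matchedCherries (T S : PTree) (L : List ℕ) : ℕ :=
  (cherryList T 0).countP fun p =>
    (cherryList S 0).any fun q =>
      (L.getD p.1 0 == q.1 && L.getD p.2 0 == q.2) ||
      (L.getD p.1 0 == q.2 && L.getD p.2 0 == q.1)

/-- The number of automorphisms of the tanglegram represented by the triple `(T, L, S)`:
pairs of automorphisms of the two trees compatible with the matching `L`. -/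
def tangleAutCount (T S : PTree) (L : List ℕ) : ℕ :=
  ((isoFuns T T).map fun a =>
    (isoFuns S S).countP fun b =>
      (List.range T.size).all fun i => L.getD (a i) 0 == b (L.getD i 0)).sum

/-- The number of automorphisms of `T` whose cycle type is `μ(s) = 2^s 1^(n-2s)`,
i.e. involutions of the leaves moving exactly `2 s` leaves. -/
def autMuCount (T : PTree) (s : ℕ) : ℕ :=
  (isoFuns T T).countP fun f =>
    ((List.range T.size).all fun i => f (f i) == i) &&
    ((List.range T.size).countP fun i => !(f i == i)) == 2 * s

end PTree

namespace PTree

/-- `μ_B = 2^(1-|B|)/|A(B)|`. -/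
noncomputable def muB (B : PTree) : ℝ := 2 / (2 ^ B.size * ((isoFuns B B).length : ℝ))

theorem size_pos (T : PTree) : 0 < T.size := by
  induction T with
  | leaf => simp [size]
  | node l r _ _ => simp only [size]; omega

theorem mem_planeTrees {T : PTree} {n : ℕ} : T ∈ planeTrees n ↔ T.size = n := by
  induction T generalizing n with
  | leaf =>
    match n with
    | 0 => simp [planeTrees, size]
    | 1 => simp [planeTrees, size]
    | n + 2 => simp [planeTrees, size]
  | node l r ihl ihr =>
    have hl := size_pos l
    have hr := size_pos r
    match n with
    | 0 => simp [planeTrees, size]; omega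
    | 1 => simp [planeTrees, size]; omega
    | n + 2 =>
      simp only [planeTrees, Finset.mem_biUnion, Finset.mem_attach, true_and, Finset.mem_image,
        Finset.mem_product, Prod.exists, node.injEq, Subtype.exists, Finset.mem_range, size]
      constructor
      · rintro ⟨k, hk, l', r', ⟨h1, h2⟩, rfl, rfl⟩
        rw [ihl] at h1
        rw [ihr] at h2
        omega
      · intro h
        exact ⟨l.size - 1, by omega, l, r, ⟨ihl.2 (by omega), ihr.2 (by omega)⟩, rfl, rfl⟩

theorem sum_planeTrees {M : Type*} [AddCommMonoid M] (f : PTree → M) {n : ℕ} (hn : n ≠ 1) :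
    ∑ T ∈ planeTrees n, f T = ∑ p ∈ Finset.HasAntidiagonal.antidiagonal n,
      ∑ l ∈ planeTrees p.1, ∑ r ∈ planeTrees p.2, f (node l r) := by
  simp_rw [← Finset.sum_product']
  rw [Finset.sum_sigma']
  symm
  refine Finset.sum_bij (fun x _ => node x.2.1 x.2.2) ?_ ?_ ?_ ?_
  · rintro ⟨⟨i, j⟩, l, r⟩ h
    simp only [Finset.mem_sigma, Finset.HasAntidiagonal.mem_antidiagonal, Finset.mem_product,
      mem_planeTrees] at h
    simp only [mem_planeTrees, size]
    omega
  · rintro ⟨⟨i, j⟩, l, r⟩ h ⟨⟨i', j'⟩, l', r'⟩ h' e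
    simp only [Finset.mem_sigma, Finset.HasAntidiagonal.mem_antidiagonal, Finset.mem_product,
      mem_planeTrees] at h h'
    simp only [node.injEq] at e
    obtain ⟨rfl, rfl⟩ := e
    obtain ⟨-, rfl, rfl⟩ := h
    obtain ⟨-, rfl, rfl⟩ := h'
    rfl
  · intro T hT
    rw [mem_planeTrees] at hT
    cases T with
    | leaf => exact absurd hT.symm hn
    | node l r =>
      refine ⟨⟨(l.size, r.size), l, r⟩, ?_, rfl⟩
      simpa [mem_planeTrees, size] using hT
  · intros; rfl

theorem sum_planeTrees' {M : Type*} [AddCommMonoid M] (f : PTree → M) (n : ℕ) :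
    ∑ T ∈ planeTrees n, f T = (if n = 1 then f leaf else 0) +
      ∑ p ∈ Finset.HasAntidiagonal.antidiagonal n,
        ∑ l ∈ planeTrees p.1, ∑ r ∈ planeTrees p.2, f (node l r) := by
  split_ifs with h
  · subst h
    have : Finset.HasAntidiagonal.antidiagonal 1 = {(0, 1), (1, 0)} := rfl
    simp [this, planeTrees]
  · rw [sum_planeTrees f h, zero_add]

theorem mem_isoFuns_node {l r l' r' : PTree} {f : ℕ → ℕ} :
    f ∈ isoFuns (node l r) (node l' r') ↔
      (∃ g ∈ isoFuns l l', ∃ h ∈ isoFuns r r',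
        (fun i => if i < l.size then g i else h (i - l.size) + l'.size) = f) ∨
      (∃ g ∈ isoFuns l r', ∃ h ∈ isoFuns r l',
        (fun i => if i < l.size then g i + l'.size else h (i - l.size)) = f) := by
  simp [isoFuns]

theorem size_eq_of_mem_isoFuns {T T' : PTree} {f : ℕ → ℕ} (hf : f ∈ isoFuns T T') :
    T.size = T'.size := by
  induction T generalizing T' f with
  | leaf => cases T' <;> simp_all [isoFuns, size]
  | node l r ihl ihr =>
    cases T' with
    | leaf => simp [isoFuns] at hf
    | node l' r' =>
      rw [mem_isoFuns_node] at hf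
      rcases hf with ⟨g, hg, h, hh, rfl⟩ | ⟨g, hg, h, hh, rfl⟩
      · simp only [size, ihl hg, ihr hh]
      · simp only [size, ihl hg, ihr hh]; omega

theorem lt_of_mem_isoFuns {T T' : PTree} {f : ℕ → ℕ} (hf : f ∈ isoFuns T T') {i : ℕ}
    (hi : i < T.size) : f i < T'.size := by
  induction T generalizing T' f i with
  | leaf => cases T' <;> simp_all [isoFuns, size]
  | node l r ihl ihr =>
    cases T' with
    | leaf => simp [isoFuns] at hf
    | node l' r' =>
      simp only [size] at hi ⊢
      rw [mem_isoFuns_node] at hf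
      rcases hf with ⟨g, hg, h, hh, rfl⟩ | ⟨g, hg, h, hh, rfl⟩
      all_goals
        dsimp only
        split_ifs with hil
        · have := ihl hg hil
          omega
        · have := ihr hh (i := i - l.size) (by omega)
          omega

theorem exists_refl_isoFuns (T : PTree) : ∃ f ∈ isoFuns T T, ∀ i < T.size, f i = i := by
  induction T with
  | leaf => exact ⟨_, by simp [isoFuns], fun i _ => rfl⟩
  | node l r ihl ihr =>
    obtain ⟨g, hg, hg'⟩ := ihl
    obtain ⟨h, hh, hh'⟩ := ihr
    refine ⟨_, mem_isoFuns_node.2 (Or.inl ⟨g, hg, h, hh, rfl⟩), fun i hi => ?_⟩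
    simp only [size] at hi
    split_ifs with hil
    · exact hg' i hil
    · rw [hh' _ (by omega)]; omega

theorem exists_symm_isoFuns {T T' : PTree} {f : ℕ → ℕ} (hf : f ∈ isoFuns T T') :
    ∃ f' ∈ isoFuns T' T, ∀ i < T.size, f' (f i) = i := by
  induction T generalizing T' f with
  | leaf =>
    cases T' with
    | leaf => exact ⟨f, hf, by simp_all [isoFuns]⟩
    | node _ _ => simp [isoFuns] at hf
  | node l r ihl ihr =>
    cases T' with
    | leaf => simp [isoFuns] at hf
    | node l' r' =>
      rw [mem_isoFuns_node] at hf
      rcases hf with ⟨g, hg, h, hh, rfl⟩ | ⟨g, hg, h, hh, rfl⟩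
      · obtain ⟨g', hg', eg⟩ := ihl hg
        obtain ⟨h', hh', eh⟩ := ihr hh
        refine ⟨_, mem_isoFuns_node.2 (Or.inl ⟨g', hg', h', hh', rfl⟩), fun i hi => ?_⟩
        simp only [size] at hi
        dsimp only
        by_cases hil : i < l.size
        · simp [hil, lt_of_mem_isoFuns hg hil, eg i hil]
        · simp only [hil, if_false]
          rw [if_neg (by omega), Nat.add_sub_cancel, eh _ (by omega)]
          omega
      · obtain ⟨g', hg', eg⟩ := ihl hg
        obtain ⟨h', hh', eh⟩ := ihr hh
        refine ⟨_, mem_isoFuns_node.2 (Or.inr ⟨h', hh', g', hg', rfl⟩), fun i hi => ?_⟩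
        simp only [size] at hi
        dsimp only
        by_cases hil : i < l.size
        · simp only [hil, if_true]
          rw [if_neg (by omega), Nat.add_sub_cancel, eg _ hil]
        · simp only [hil, if_false]
          rw [if_pos (lt_of_mem_isoFuns hh (by omega)), eh _ (by omega)]
          omega

theorem exists_trans_isoFuns {T T' T'' : PTree} {f g : ℕ → ℕ} (hf : f ∈ isoFuns T T')
    (hg : g ∈ isoFuns T' T'') : ∃ h ∈ isoFuns T T'', ∀ i < T.size, h i = g (f i) := by
  induction T generalizing T' T'' f g with
  | leaf =>
    cases T' with
    | leaf => exact ⟨g, hg, by simp_all [isoFuns]⟩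
    | node _ _ => simp [isoFuns] at hf
  | node l r ihl ihr =>
    cases T' with
    | leaf => simp [isoFuns] at hf
    | node l' r' =>
      cases T'' with
      | leaf => simp [isoFuns] at hg
      | node l'' r'' =>
      rw [mem_isoFuns_node] at hf hg
      rcases hf with ⟨f₁, hf₁, f₂, hf₂, rfl⟩ | ⟨f₁, hf₁, f₂, hf₂, rfl⟩ <;>
      rcases hg with ⟨g₁, hg₁, g₂, hg₂, rfl⟩ | ⟨g₁, hg₁, g₂, hg₂, rfl⟩
      · obtain ⟨h₁, hh₁, e₁⟩ := ihl hf₁ hg₁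
        obtain ⟨h₂, hh₂, e₂⟩ := ihr hf₂ hg₂
        refine ⟨_, mem_isoFuns_node.2 (Or.inl ⟨h₁, hh₁, h₂, hh₂, rfl⟩), fun i hi => ?_⟩
        simp only [size] at hi
        by_cases hil : i < l.size
        · simp [hil, lt_of_mem_isoFuns hf₁ hil, e₁ i hil]
        · simp [hil, e₂ (i - l.size) (by omega)]
      · obtain ⟨h₁, hh₁, e₁⟩ := ihl hf₁ hg₁
        obtain ⟨h₂, hh₂, e₂⟩ := ihr hf₂ hg₂
        refine ⟨_, mem_isoFuns_node.2 (Or.inr ⟨h₁, hh₁, h₂, hh₂, rfl⟩), fun i hi => ?_⟩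
        simp only [size] at hi
        by_cases hil : i < l.size
        · simp [hil, lt_of_mem_isoFuns hf₁ hil, e₁ i hil]
        · simp [hil, e₂ (i - l.size) (by omega)]
      · obtain ⟨h₁, hh₁, e₁⟩ := ihl hf₁ hg₂
        obtain ⟨h₂, hh₂, e₂⟩ := ihr hf₂ hg₁
        refine ⟨_, mem_isoFuns_node.2 (Or.inr ⟨h₁, hh₁, h₂, hh₂, rfl⟩), fun i hi => ?_⟩
        simp only [size] at hi
        by_cases hil : i < l.size
        · simp [hil, e₁ i hil]
        · have := lt_of_mem_isoFuns hf₂ (i := i - l.size) (by omega)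
          simp [hil, e₂ (i - l.size) (by omega), this]
      · obtain ⟨h₁, hh₁, e₁⟩ := ihl hf₁ hg₂
        obtain ⟨h₂, hh₂, e₂⟩ := ihr hf₂ hg₁
        refine ⟨_, mem_isoFuns_node.2 (Or.inl ⟨h₁, hh₁, h₂, hh₂, rfl⟩), fun i hi => ?_⟩
        simp only [size] at hi
        by_cases hil : i < l.size
        · simp [hil, e₁ i hil]
        · have := lt_of_mem_isoFuns hf₂ (i := i - l.size) (by omega)
          simp [hil, e₂ (i - l.size) (by omega), this]

theorem pairwise_isoFuns (T T' : PTree) :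
    (isoFuns T T').Pairwise fun f g => ∃ i < T.size, f i ≠ g i := by
  induction T generalizing T' with
  | leaf => cases T' <;> simp [isoFuns]
  | node l r ihl ihr =>
    cases T' with
    | leaf => simp [isoFuns]
    | node l' r' =>
      have hl := size_pos l
      simp only [isoFuns, List.pairwise_append, List.pairwise_flatMap, List.pairwise_map,
        List.mem_flatMap, List.mem_map, size]
      refine ⟨⟨fun g _ => ?_, ?_⟩, ⟨fun g _ => ?_, ?_⟩, ?_⟩
      · refine (ihr r').imp ?_
        rintro f₁ f₂ ⟨i, hi, hne⟩
        exact ⟨i + l.size, by omega, by simpa using hne⟩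
      · refine (ihl l').imp ?_
        rintro f₁ f₂ ⟨i, hi, hne⟩ _ ⟨_, _, rfl⟩ _ ⟨_, _, rfl⟩
        exact ⟨i, by omega, by simpa [hi] using hne⟩
      · refine (ihr l').imp ?_
        rintro f₁ f₂ ⟨i, hi, hne⟩
        exact ⟨i + l.size, by omega, by simpa using hne⟩
      · refine (ihl r').imp ?_
        rintro f₁ f₂ ⟨i, hi, hne⟩ _ ⟨_, _, rfl⟩ _ ⟨_, _, rfl⟩
        exact ⟨i, by omega, by simpa [hi] using hne⟩
      · rintro _ ⟨g, hg, _, _, rfl⟩ _ ⟨_, _, _, _, rfl⟩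
        refine ⟨0, by omega, ?_⟩
        have := lt_of_mem_isoFuns hg hl
        simp only [hl, if_true]
        omega

theorem length_isoFuns_node (l r l' r' : PTree) :
    (isoFuns (node l r) (node l' r')).length =
      (isoFuns l l').length * (isoFuns r r').length +
      (isoFuns l r').length * (isoFuns r l').length := by
  simp [isoFuns, List.length_flatMap]

theorem length_isoFuns_eq_zero {T T' : PTree} (h : T.size ≠ T'.size) :
    (isoFuns T T').length = 0 := by
  rw [List.length_eq_zero_iff, List.eq_nil_iff_forall_not_mem]
  exact fun f hf => h (size_eq_of_mem_isoFuns hf)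

theorem sum_length_isoFuns (T : PTree) :
    2 * ∑ T' ∈ planeTrees T.size, (isoFuns T T').length = 2 ^ T.size := by
  induction T with
  | leaf => simp [size, planeTrees, isoFuns]
  | node l r ihl ihr =>
    have hl := size_pos l
    have hr := size_pos r
    simp only [size] at *
    rw [sum_planeTrees _ (by omega)]
    simp only [length_isoFuns_node, Finset.sum_add_distrib]
    have key : ∀ a b : PTree, a.size + b.size = l.size + r.size →
        ∑ p ∈ Finset.HasAntidiagonal.antidiagonal (l.size + r.size), ∑ x ∈ planeTrees p.1,
          ∑ y ∈ planeTrees p.2, (isoFuns a x).length * (isoFuns b y).length =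
        (∑ x ∈ planeTrees a.size, (isoFuns a x).length) *
          ∑ y ∈ planeTrees b.size, (isoFuns b y).length := by
      intro a b hab
      rw [Finset.sum_eq_single (a.size, b.size)]
      · rw [Finset.sum_mul_sum]
      · rintro ⟨i, j⟩ hp hne
        rw [Finset.HasAntidiagonal.mem_antidiagonal] at hp
        refine Finset.sum_eq_zero fun x hx => Finset.sum_eq_zero fun y hy => ?_
        rw [mem_planeTrees] at hx hy
        simp only at hx hy hp
        rw [length_isoFuns_eq_zero, zero_mul]
        rintro h
        apply hne
        ext <;> simp <;> omega
      · simp [hab]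
    rw [key l r rfl]
    have h2 := key r l (by omega)
    have h3 : ∑ p ∈ Finset.HasAntidiagonal.antidiagonal (l.size + r.size), ∑ x ∈ planeTrees p.1,
        ∑ y ∈ planeTrees p.2, (isoFuns l y).length * (isoFuns r x).length = _ :=
      (Finset.sum_congr rfl fun p _ => Finset.sum_congr rfl fun x _ =>
        Finset.sum_congr rfl fun y _ => mul_comm _ _).trans h2
    rw [h3, pow_add, ← ihl, ← ihr]
    ring

theorem encode_injective : Function.Injective encode := by
  intro T
  induction T with
  | leaf => intro T' h; cases T' <;> simp_all [encode]
  | node l r ihl ihr =>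
    intro T' h
    cases T' with
    | leaf => simp [encode] at h
    | node l' r' =>
      simp only [encode, Nat.add_right_cancel_iff, Nat.pair_eq_pair] at h
      rw [ihl h.1, ihr h.2]

theorem normalize_node_comm (l r : PTree) : normalize (node l r) = normalize (node r l) := by
  simp only [normalize]
  split_ifs with h1 h2 h2
  · rw [encode_injective (le_antisymm h1 h2)]
  · rfl
  · rfl
  · omega

theorem normalize_node_congr {l r l' r' : PTree} (hl : normalize l = normalize l')
    (hr : normalize r = normalize r') : normalize (node l r) = normalize (node l' r') := by
  simp only [normalize, hl, hr]

theorem normalize_eq_and_occ_eq_of_mem_isoFuns (B : PTree) {T T' : PTree} {f : ℕ → ℕ}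
    (hf : f ∈ isoFuns T T') : normalize T = normalize T' ∧ occ B T = occ B T' := by
  induction T generalizing T' f with
  | leaf => cases T' <;> simp_all [isoFuns]
  | node l r ihl ihr =>
    cases T' with
    | leaf => simp [isoFuns] at hf
    | node l' r' =>
      rw [mem_isoFuns_node] at hf
      rcases hf with ⟨g, hg, h, hh, rfl⟩ | ⟨g, hg, h, hh, rfl⟩
      · have e := normalize_node_congr (ihl hg).1 (ihr hh).1
        exact ⟨e, by simp only [occ, e, (ihl hg).2, (ihr hh).2]⟩
      · have e := normalize_node_congr (ihl hg).1 (ihr hh).1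
        rw [normalize_node_comm r'] at e
        refine ⟨e, ?_⟩
        simp only [occ, e, (ihl hg).2, (ihr hh).2]
        omega

theorem exists_mem_isoFuns_normalize (T : PTree) : ∃ f, f ∈ isoFuns T (normalize T) := by
  induction T with
  | leaf => simp [normalize, isoFuns]
  | node l r ihl ihr =>
    obtain ⟨g, hg⟩ := ihl
    obtain ⟨h, hh⟩ := ihr
    simp only [normalize]
    split_ifs
    · exact ⟨_, mem_isoFuns_node.2 (Or.inl ⟨g, hg, h, hh, rfl⟩)⟩
    · exact ⟨_, mem_isoFuns_node.2 (Or.inr ⟨g, hg, h, hh, rfl⟩)⟩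

theorem exists_mem_isoFuns_of_normalize_eq {T T' : PTree} (h : normalize T = normalize T') :
    ∃ f, f ∈ isoFuns T T' := by
  obtain ⟨f, hf⟩ := exists_mem_isoFuns_normalize T
  obtain ⟨g, hg⟩ := exists_mem_isoFuns_normalize T'
  obtain ⟨g', hg', -⟩ := exists_symm_isoFuns hg
  rw [h] at hf
  obtain ⟨k, hk, -⟩ := exists_trans_isoFuns hf hg'
  exact ⟨k, hk⟩

theorem normalize_eq_iff {T T' : PTree} :
    normalize T = normalize T' ↔ ∃ f, f ∈ isoFuns T T' :=
  ⟨exists_mem_isoFuns_of_normalize_eq,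
    fun ⟨_, hf⟩ => (normalize_eq_and_occ_eq_of_mem_isoFuns leaf hf).1⟩

theorem size_eq_of_normalize_eq {T T' : PTree} (h : normalize T = normalize T') :
    T.size = T'.size := by
  obtain ⟨f, hf⟩ := normalize_eq_iff.1 h
  exact size_eq_of_mem_isoFuns hf

/-- The isomorphisms between two trees with `n` leaves, as permutations of the leaf positions. -/
noncomputable def isoPerms (n : ℕ) (T T' : PTree) : Finset (Equiv.Perm (Fin n)) :=
  Finset.univ.filter fun σ => ∃ f ∈ isoFuns T T', ∀ i : Fin n, f i = σ i

theorem mem_isoPerms {n : ℕ} {T T' : PTree} {σ : Equiv.Perm (Fin n)} :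
    σ ∈ isoPerms n T T' ↔ ∃ f ∈ isoFuns T T', ∀ i : Fin n, f i = σ i := by
  simp [isoPerms]

theorem one_mem_isoPerms {n : ℕ} {T : PTree} (hT : T.size = n) : 1 ∈ isoPerms n T T := by
  obtain ⟨f, hf, e⟩ := exists_refl_isoFuns T
  exact mem_isoPerms.2 ⟨f, hf, fun i => e i (hT ▸ i.2)⟩

theorem inv_mem_isoPerms {n : ℕ} {T T' : PTree} (hT : T.size = n) {σ : Equiv.Perm (Fin n)}
    (h : σ ∈ isoPerms n T T') : σ⁻¹ ∈ isoPerms n T' T := by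
  obtain ⟨f, hf, e⟩ := mem_isoPerms.1 h
  obtain ⟨g, hg, e'⟩ := exists_symm_isoFuns hf
  refine mem_isoPerms.2 ⟨g, hg, fun i => ?_⟩
  have := e' (σ⁻¹ i : Fin n) (hT ▸ (σ⁻¹ i).2)
  rwa [e, show σ (σ⁻¹ i) = i by simp] at this

theorem mul_mem_isoPerms {n : ℕ} {T T' T'' : PTree} (hT : T.size = n) {σ τ : Equiv.Perm (Fin n)}
    (h : σ ∈ isoPerms n T T') (h' : τ ∈ isoPerms n T' T'') : τ * σ ∈ isoPerms n T T'' := by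
  obtain ⟨f, hf, e⟩ := mem_isoPerms.1 h
  obtain ⟨g, hg, e'⟩ := mem_isoPerms.1 h'
  obtain ⟨k, hk, e''⟩ := exists_trans_isoFuns hf hg
  refine mem_isoPerms.2 ⟨k, hk, fun i => ?_⟩
  rw [e'' i (hT ▸ i.2), e, e', Equiv.Perm.mul_apply]

/-- An isomorphism out of a tree with `n` leaves acts on the leaf positions as a permutation. -/
theorem exists_perm_of_mem_isoFuns {n : ℕ} {T T' : PTree} (hT : T.size = n) {f : ℕ → ℕ}
    (hf : f ∈ isoFuns T T') : ∃ σ : Equiv.Perm (Fin n), ∀ i : Fin n, f i = σ i := by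
  subst hT
  obtain ⟨g, hg, e⟩ := exists_symm_isoFuns hf
  have hs := size_eq_of_mem_isoFuns hf
  let F : Fin T.size → Fin T.size := fun i => ⟨f i, (lt_of_mem_isoFuns hf i.2).trans_eq hs.symm⟩
  have hF : Function.Injective F := by
    intro i j h
    have h' : f i = f j := congrArg Fin.val h
    exact Fin.ext (by rw [← e i i.2, ← e j j.2, h'])
  exact ⟨Equiv.ofBijective F (Finite.injective_iff_bijective.1 hF), fun i => rfl⟩

/-- The permutation of the leaf positions induced by an isomorphism. -/
noncomputable def toPerm (n : ℕ) (f : ℕ → ℕ) : Equiv.Perm (Fin n) :=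
  if h : ∃ σ : Equiv.Perm (Fin n), ∀ i : Fin n, f i = σ i then h.choose else 1

theorem toPerm_apply {n : ℕ} {T T' : PTree} (hT : T.size = n) {f : ℕ → ℕ}
    (hf : f ∈ isoFuns T T') (i : Fin n) : (toPerm n f i : ℕ) = f i := by
  have h := exists_perm_of_mem_isoFuns hT hf
  rw [toPerm, dif_pos h, h.choose_spec i]

theorem isoPerms_eq_toFinset {n : ℕ} {T T' : PTree} (hT : T.size = n) :
    isoPerms n T T' = ((isoFuns T T').map (toPerm n)).toFinset := by
  ext σ
  simp only [mem_isoPerms, List.mem_toFinset, List.mem_map]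
  refine exists_congr fun f => and_congr_right fun hf => ?_
  constructor
  · exact fun h => Equiv.ext fun i => Fin.ext (by rw [toPerm_apply hT hf, h])
  · rintro rfl i
    rw [toPerm_apply hT hf]

theorem nodup_map_toPerm {n : ℕ} {T T' : PTree} (hT : T.size = n) :
    ((isoFuns T T').map (toPerm n)).Nodup := by
  rw [List.Nodup, List.pairwise_map]
  refine (List.pairwise_iff_forall_sublist.2 ?_)
  intro f g h
  have hf : f ∈ isoFuns T T' := h.subset (by simp)
  have hg : g ∈ isoFuns T T' := h.subset (by simp)
  obtain ⟨i, hi, hne⟩ := List.pairwise_iff_forall_sublist.1 (pairwise_isoFuns T T') h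
  intro e
  apply hne
  rw [hT] at hi
  rw [← toPerm_apply hT hf ⟨i, hi⟩, ← toPerm_apply hT hg ⟨i, hi⟩, e]

theorem card_isoPerms {n : ℕ} {T T' : PTree} (hT : T.size = n) :
    (isoPerms n T T').card = (isoFuns T T').length := by
  rw [isoPerms_eq_toFinset hT, List.toFinset_card_of_nodup (nodup_map_toPerm hT), List.length_map]

theorem length_isoFuns_eq_ite (B T : PTree) :
    (isoFuns B T).length = if normalize T = normalize B then (isoFuns B B).length else 0 := by
  split_ifs with h
  · obtain ⟨f, hf⟩ := normalize_eq_iff.1 h.symm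
    have hσ : toPerm B.size f ∈ isoPerms B.size B T :=
      mem_isoPerms.2 ⟨f, hf, fun i => (toPerm_apply rfl hf i).symm⟩
    have hs := size_eq_of_normalize_eq h
    rw [← card_isoPerms rfl, ← card_isoPerms rfl]
    refine Finset.card_bij' (fun τ _ => (toPerm B.size f)⁻¹ * τ) (fun τ _ => toPerm B.size f * τ)
      (fun τ hτ => mul_mem_isoPerms rfl hτ (inv_mem_isoPerms rfl hσ))
      (fun τ hτ => mul_mem_isoPerms rfl hτ hσ) ?_ ?_ <;> simp
  · rw [List.length_eq_zero_iff, List.eq_nil_iff_forall_not_mem]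
    exact fun f hf => h (normalize_eq_iff.2 ⟨f, hf⟩).symm

/-- The number of plane representations of the binary tree represented by `B`. -/
noncomputable def numPlane (B : PTree) : ℕ :=
  ((planeTrees B.size).filter fun T => normalize T = normalize B).card

theorem two_mul_numPlane_mul_length (B : PTree) :
    2 * (numPlane B * (isoFuns B B).length) = 2 ^ B.size := by
  rw [← sum_length_isoFuns, numPlane]
  congr 1
  rw [Finset.sum_congr rfl fun T _ => length_isoFuns_eq_ite B T, ← Finset.sum_filter,
    Finset.sum_const, smul_eq_mul]

/-- The number of leaves moved by a map on the leaf positions of a tree with `n` leaves. -/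
def moved (n : ℕ) (f : ℕ → ℕ) : ℕ := ((Finset.range n).filter fun i => f i ≠ i).card

theorem moved_add_of_parts {a b : ℕ} (g h : ℕ → ℕ) :
    moved (a + b) (fun i => if i < a then g i else h (i - a) + a) = moved a g + moved b h := by
  simp only [moved, Finset.card_filter, Finset.sum_range_add]
  congr 1
  · refine Finset.sum_congr rfl fun i hi => ?_
    simp [Finset.mem_range.1 hi]
  · refine Finset.sum_congr rfl fun i _ => ?_
    simp [add_comm a i]

theorem moved_eq_of_forall_ne {n : ℕ} {f : ℕ → ℕ} (h : ∀ i < n, f i ≠ i) : moved n f = n := by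
  rw [moved, Finset.filter_true_of_mem (by simpa using h), Finset.card_range]

theorem two_mul_length_isoFuns_le (T T' : PTree) : 2 * (isoFuns T T').length ≤ 2 ^ T.size := by
  by_cases h : T.size = T'.size
  · rw [← sum_length_isoFuns T]
    exact Nat.mul_le_mul_left 2 (Finset.single_le_sum (f := fun T' => (isoFuns T T').length)
      (fun _ _ => Nat.zero_le _) (mem_planeTrees.2 h.symm))
  · simp [length_isoFuns_eq_zero h]

theorem sum_pow_moved_le (T : PTree) {x : ℝ} (hx : 0 ≤ x) :
    ((isoFuns T T).map fun f => x ^ moved T.size f).sum ≤ (1 + x ^ 2) ^ (T.size - 1) := by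
  induction T with
  | leaf => simp [isoFuns, size, moved]
  | node l r ihl ihr =>
    have hl := size_pos l
    have hr := size_pos r
    have h1 : (((isoFuns l l).flatMap fun g => (isoFuns r r).map fun h =>
        fun i => if i < l.size then g i else h (i - l.size) + l.size).map
          fun f => x ^ moved (l.size + r.size) f).sum =
        ((isoFuns l l).map fun f => x ^ moved l.size f).sum *
          ((isoFuns r r).map fun f => x ^ moved r.size f).sum := by
      rw [List.map_flatMap, List.flatMap_def, List.sum_flatten]
      simp only [List.map_map, Function.comp_def, moved_add_of_parts, pow_add, List.sum_map_mul_left,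
        List.sum_map_mul_right]
    have h2 : (((isoFuns l r).flatMap fun g => (isoFuns r l).map fun h =>
        fun i => if i < l.size then g i + l.size else h (i - l.size)).map
          fun f => x ^ moved (l.size + r.size) f).sum ≤
        2 ^ (l.size + r.size - 2) * x ^ (l.size + r.size) := by
      have : ∀ y ∈ (((isoFuns l r).flatMap fun g => (isoFuns r l).map fun h =>
          fun i => if i < l.size then g i + l.size else h (i - l.size)).map
            fun f => x ^ moved (l.size + r.size) f), y ≤ x ^ (l.size + r.size) := by
        simp only [List.mem_map, List.mem_flatMap]
        rintro _ ⟨_, ⟨g, hg, h, hh, rfl⟩, rfl⟩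
        rw [moved_eq_of_forall_ne]
        intro i hi
        split_ifs with hil
        · omega
        · have := lt_of_mem_isoFuns hh (i := i - l.size) (by omega)
          omega
      refine (List.sum_le_card_nsmul _ _ this).trans ?_
      rw [nsmul_eq_mul]
      refine mul_le_mul_of_nonneg_right ?_ (by positivity)
      simp only [List.length_map, List.length_flatMap, List.map_const', List.sum_replicate,
        smul_eq_mul]
      have e1 := two_mul_length_isoFuns_le l r
      have e2 := two_mul_length_isoFuns_le r l
      have e3 := Nat.mul_le_mul e1 e2
      rw [← pow_add, show l.size + r.size = (l.size + r.size - 2) + 2 by omega, pow_add] at e3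
      have : (isoFuns l r).length * (isoFuns r l).length ≤ 2 ^ (l.size + r.size - 2) := by
        linarith
      exact_mod_cast this
    simp only [isoFuns, size, List.map_append, List.sum_append, h1]
    refine (add_le_add (mul_le_mul ihl ihr ?_ (by positivity)) h2).trans ?_
    · exact List.sum_nonneg (by simp only [List.mem_map]; rintro _ ⟨f, -, rfl⟩; positivity)
    · rw [← pow_add, show l.size - 1 + (r.size - 1) = l.size + r.size - 2 by omega,
        show l.size + r.size - 1 = l.size + r.size - 2 + 1 by omega]
      obtain ⟨k, hk⟩ : ∃ k, l.size + r.size = k + 2 := ⟨l.size + r.size - 2, by omega⟩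
      rw [hk, Nat.add_sub_cancel, pow_succ (1 + x ^ 2), pow_add, ← mul_assoc, ← mul_pow]
      have : (2 * x) ^ k ≤ (1 + x ^ 2) ^ k :=
        pow_le_pow_left₀ (by positivity) (by nlinarith [sq_nonneg (x - 1)]) k
      nlinarith [mul_le_mul_of_nonneg_right this (sq_nonneg x)]

/-- Permutations intertwining `a` with `b`: such a permutation is determined by its restriction
to the fixed points of `a` and its values at one point of each nontrivial cycle of `a`. -/
theorem card_intertwining_le {α : Type*} [Fintype α] [DecidableEq α] (a b : Equiv.Perm α)
    (hab : a.support.card = b.support.card) :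
    (Finset.univ.filter fun v : Equiv.Perm α => v * a = b * v).card ≤
      (Fintype.card α - a.support.card).factorial *
        a.support.card ^ a.cycleType.card := by
  classical
  let V := {v : Equiv.Perm α // v * a = b * v}
  have comm : ∀ v : V, ∀ x, v.1 (a x) = b (v.1 x) := fun v x =>
    congrArg (fun w : Equiv.Perm α => w x) v.2
  have hfix : ∀ v : V, ∀ x, a x = x ↔ b (v.1 x) = v.1 x := fun v x => by
    rw [← comm v, v.1.injective.eq_iff]
  have hr : ∀ c : a.cycleFactorsFinset, ∃ x, c.1 x ≠ x := fun c =>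
    ((Equiv.Perm.mem_cycleFactorsFinset_iff.1 c.2).1).imp fun x hx => hx.1
  choose r hr using hr
  have hra : ∀ c : a.cycleFactorsFinset, a (r c) ≠ r c := fun c => by
    have := (Equiv.Perm.mem_cycleFactorsFinset_iff.1 c.2).2 (r c)
      (Equiv.Perm.mem_support.2 (hr c))
    rw [← this]
    exact hr c
  let F : V → ({x // a x = x} ≃ {x // b x = x}) × (a.cycleFactorsFinset → b.support) := fun v =>
    (v.1.subtypeEquiv (hfix v), fun c => ⟨v.1 (r c), by
      rw [Equiv.Perm.mem_support, ne_eq, ← hfix v]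
      exact hra c⟩)
  have hF : Function.Injective F := by
    intro v w h
    have h1 : ∀ x, a x = x → v.1 x = w.1 x := fun x hx =>
      congrArg Subtype.val (Equiv.congr_fun (congrArg Prod.fst h) ⟨x, hx⟩)
    have h2 : ∀ c, v.1 (r c) = w.1 (r c) := fun c =>
      congrArg Subtype.val (congrFun (congrArg Prod.snd h) c)
    have comm_pow : ∀ v : V, ∀ k : ℕ, ∀ x, v.1 ((a ^ k) x) = (b ^ k) (v.1 x) := by
      intro v k
      induction k with
      | zero => intro x; simp
      | succ k ih => intro x; rw [pow_succ, pow_succ, Equiv.Perm.mul_apply, ih, comm]; simp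
    refine Subtype.ext (Equiv.ext fun x => ?_)
    by_cases hx : a x = x
    · exact h1 x hx
    · let c : a.cycleFactorsFinset :=
        ⟨a.cycleOf x, Equiv.Perm.cycleOf_mem_cycleFactorsFinset_iff.2 (Equiv.Perm.mem_support.2 hx)⟩
      have hc : a.SameCycle x (r c) := by
        by_contra hn
        exact hr c (Equiv.Perm.cycleOf_apply_of_not_sameCycle hn)
      obtain ⟨k, -, hk⟩ := hc.symm.exists_pow_eq'
      rw [← hk, comm_pow, comm_pow, h2]
  have hcard : ∀ c : Equiv.Perm α, Fintype.card {x // c x = x} =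
      Fintype.card α - c.support.card := fun c => by
    have := Fintype.card_subtype_compl fun x => c x = x
    have h2 : Fintype.card {x // ¬ c x = x} = c.support.card :=
      Fintype.card_of_subtype _ fun x => Equiv.Perm.mem_support
    have h3 := Fintype.card_subtype_le fun x => c x = x
    omega
  have e : {x // a x = x} ≃ {x // b x = x} :=
    Fintype.equivOfCardEq (by rw [hcard, hcard, hab])
  calc _ = Fintype.card V := (Fintype.card_subtype _).symm
    _ ≤ _ := Fintype.card_le_of_injective F hF
    _ = _ := by
      rw [Fintype.card_prod, Fintype.card_equiv e, hcard, Fintype.card_fun, Fintype.card_coe,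
        Fintype.card_coe, ← hab, Equiv.Perm.cycleType_def, Multiset.card_map]
      rfl

theorem pow_card_cycleType_le {α : Type*} [Fintype α] [DecidableEq α] (a : Equiv.Perm α) :
    (a.support.card : ℝ) ^ a.cycleType.card ≤ √a.support.card ^ a.support.card := by
  have h : a.cycleType.card * 2 ≤ a.support.card := by
    rw [← a.sum_cycleType, ← smul_eq_mul]
    exact Multiset.card_nsmul_le_sum fun x hx => Equiv.Perm.two_le_of_mem_cycleType hx
  rcases Nat.eq_zero_or_pos a.support.card with h0 | h0
  · rw [h0] at h ⊢
    simp [show a.cycleType.card = 0 by omega]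
  · conv_lhs => rw [← Real.sq_sqrt (Nat.cast_nonneg a.support.card), ← pow_mul, mul_comm]
    exact pow_le_pow_right₀ (Real.one_le_sqrt.2 (by exact_mod_cast h0)) (by omega)

theorem card_intertwining_le_real {n : ℕ} (a b : Equiv.Perm (Fin n)) {m : ℕ}
    (ha : a.support.card = m) (hb : b.support.card = m) :
    ((Finset.univ.filter fun v : Equiv.Perm (Fin n) => v * a = b * v).card : ℝ) ≤
      (n - m).factorial * √m ^ m := by
  have h : ((Finset.univ.filter fun v : Equiv.Perm (Fin n) => v * a = b * v).card : ℝ) ≤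
      ((Fintype.card (Fin n) - a.support.card).factorial *
        a.support.card ^ a.cycleType.card : ℕ) := by
    exact_mod_cast card_intertwining_le a b (ha.trans hb.symm)
  have h2 := pow_card_cycleType_le a
  rw [Fintype.card_fin, ha] at h
  rw [ha] at h2
  push_cast at h
  exact h.trans (mul_le_mul_of_nonneg_left h2 (by positivity))

theorem card_support_eq_of_intertwining {α : Type*} [Fintype α] [DecidableEq α]
    {a b v : Equiv.Perm α} (h : v * a = b * v) : a.support.card = b.support.card := by
  rw [show b = v * a * v⁻¹ by rw [h, mul_inv_cancel_right], Equiv.Perm.card_support_conj]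

theorem pow_le_exp_mul_descFactorial {n m : ℕ} (h : m ≤ n) :
    (n : ℝ) ^ m ≤ Real.exp m * n.descFactorial m := by
  induction m generalizing n with
  | zero => simp
  | succ m ih =>
    obtain ⟨n, rfl⟩ : ∃ k, n = k + 1 := ⟨n - 1, by omega⟩
    have hm : m ≤ n := by omega
    have key : ((n : ℝ) + 1) ^ m ≤ Real.exp 1 * (n : ℝ) ^ m := by
      rcases Nat.eq_zero_or_pos n with rfl | hn
      · simp [show m = 0 by omega]
      · have hn' : (0 : ℝ) < n := by exact_mod_cast hn
        have h1 : (1 + 1 / (n : ℝ)) ^ m ≤ Real.exp 1 := by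
          calc (1 + 1 / (n : ℝ)) ^ m ≤ Real.exp (1 / n) ^ m :=
                pow_le_pow_left₀ (by positivity) (by linarith [Real.add_one_le_exp (1 / (n : ℝ))]) m
            _ = Real.exp (m * (1 / n)) := (Real.exp_nat_mul _ _).symm
            _ ≤ Real.exp 1 := by
              rw [Real.exp_le_exp, mul_one_div, div_le_one hn']
              exact_mod_cast hm
        calc ((n : ℝ) + 1) ^ m = (1 + 1 / (n : ℝ)) ^ m * (n : ℝ) ^ m := by
              rw [← mul_pow]; congr 1; field_simp
          _ ≤ _ := mul_le_mul_of_nonneg_right h1 (by positivity)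
    rw [Nat.succ_descFactorial_succ]
    push_cast
    rw [Real.exp_add, pow_succ]
    calc ((n : ℝ) + 1) ^ m * (n + 1) ≤ Real.exp 1 * (n : ℝ) ^ m * (n + 1) :=
          mul_le_mul_of_nonneg_right key (by positivity)
      _ ≤ Real.exp 1 * (Real.exp m * n.descFactorial m) * (n + 1) := by
          gcongr; exact ih hm
      _ = _ := by ring

theorem factorial_sub_mul_pow_le {n m : ℕ} (h : m ≤ n) :
    ((n - m).factorial : ℝ) * n ^ m ≤ Real.exp m * n.factorial := by
  rw [← Nat.factorial_mul_descFactorial h]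
  push_cast
  nlinarith [mul_le_mul_of_nonneg_left (pow_le_exp_mul_descFactorial h)
    (Nat.cast_nonneg (α := ℝ) (n - m).factorial)]

/-- The automorphisms of `T` moving exactly `m` leaves. -/
noncomputable def autMoving (n : ℕ) (T : PTree) (m : ℕ) : Finset (Equiv.Perm (Fin n)) :=
  (isoPerms n T T).filter fun σ => σ.support.card = m

theorem moved_eq_card_support {n : ℕ} {f : ℕ → ℕ} {σ : Equiv.Perm (Fin n)}
    (h : ∀ i : Fin n, f i = σ i) : moved n f = σ.support.card := by
  rw [moved, Finset.card_filter, Finset.sum_range, ← Finset.card_filter]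
  congr 1
  ext i
  simp [h, Fin.ext_iff]

theorem card_autMoving_mul_pow_le {n : ℕ} {T : PTree} (hT : T.size = n) (m : ℕ) {x : ℝ}
    (hx : 0 ≤ x) : (autMoving n T m).card * x ^ m ≤ (1 + x ^ 2) ^ n := by
  have h1 : ∑ σ ∈ isoPerms n T T, x ^ σ.support.card ≤ (1 + x ^ 2) ^ (n - 1) := by
    rw [isoPerms_eq_toFinset hT, List.sum_toFinset _ (nodup_map_toPerm hT), List.map_map]
    refine le_trans (le_of_eq ?_) (hT ▸ sum_pow_moved_le T hx)
    congr 1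
    refine List.map_congr_left fun f hf => ?_
    rw [Function.comp_apply, moved_eq_card_support fun i => (toPerm_apply hT hf i).symm]
  calc (autMoving n T m).card * x ^ m = ∑ σ ∈ autMoving n T m, x ^ σ.support.card := by
        rw [Finset.sum_congr rfl fun σ hσ => by rw [(Finset.mem_filter.1 hσ).2],
          Finset.sum_const, nsmul_eq_mul]
    _ ≤ ∑ σ ∈ isoPerms n T T, x ^ σ.support.card :=
        Finset.sum_le_sum_of_subset_of_nonneg (Finset.filter_subset _ _)
          fun _ _ _ => by positivity
    _ ≤ (1 + x ^ 2) ^ (n - 1) := h1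
    _ ≤ (1 + x ^ 2) ^ n := pow_le_pow_right₀ (by nlinarith [sq_nonneg x]) (by omega)

theorem card_autMoving_mul_sqrt_pow_le {n : ℕ} (hn : 0 < n) {T : PTree} (hT : T.size = n)
    (m : ℕ) : (autMoving n T m).card * √m ^ m ≤ Real.exp m * √n ^ m := by
  have hn' : (0 : ℝ) < n := by exact_mod_cast hn
  have h := card_autMoving_mul_pow_le hT m (Real.sqrt_nonneg ((m : ℝ) / n))
  rw [Real.sq_sqrt (by positivity), Real.sqrt_div (by positivity), div_pow] at h
  have h2 : (1 + (m : ℝ) / n) ^ n ≤ Real.exp m := by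
    calc (1 + (m : ℝ) / n) ^ n ≤ Real.exp (m / n) ^ n :=
          pow_le_pow_left₀ (by positivity) (by linarith [Real.add_one_le_exp ((m : ℝ) / n)]) n
      _ = Real.exp m := by rw [← Real.exp_nat_mul]; congr 1; field_simp
  have hpos : 0 < √(n : ℝ) ^ m := pow_pos (Real.sqrt_pos.2 hn') m
  have h3 := h.trans h2
  rwa [← mul_div_assoc, div_le_iff₀ hpos] at h3

theorem summable_exp_div_sqrt_pow :
    Summable fun m : ℕ => Real.exp (3 * m) / √m ^ m := by
  have hg : Summable fun m : ℕ => (1 / 2 : ℝ) ^ m := summable_geometric_two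
  refine Summable.of_norm_bounded_eventually_nat hg ?_
  have ht : Filter.Tendsto (fun m : ℕ => √(m : ℝ)) Filter.atTop Filter.atTop :=
    Real.tendsto_sqrt_atTop.comp tendsto_natCast_atTop_atTop
  filter_upwards [ht.eventually_ge_atTop (2 * Real.exp 3)] with m hm
  rw [Real.norm_of_nonneg (by positivity), mul_comm, Real.exp_nat_mul, ← div_pow]
  refine pow_le_pow_left₀ (by positivity) ?_ m
  rw [div_le_div_iff₀ (by linarith [Real.exp_pos 3]) two_pos]
  linarith

/-- A uniform bound for the average number of automorphisms of a tanglegram with given halves. -/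
noncomputable def autBound : ℝ := ∑' m : ℕ, Real.exp (3 * m) / √m ^ m

theorem autMoving_mul_intertwining_le {n m : ℕ} (hn : 0 < n) (hm : m ≤ n) {T S : PTree}
    (hT : T.size = n) (hS : S.size = n) :
    ((autMoving n T m).card : ℝ) * (autMoving n S m).card * ((n - m).factorial * √m ^ m) ≤
      Real.exp (3 * m) / √m ^ m * n.factorial := by
  have hpos : 0 < √(m : ℝ) ^ m := by
    rcases Nat.eq_zero_or_pos m with rfl | h
    · simp
    · have : (0 : ℝ) < m := by exact_mod_cast h
      positivity
  have h1 := card_autMoving_mul_sqrt_pow_le hn hT m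
  have h2 := card_autMoving_mul_sqrt_pow_le hn hS m
  have h3 := mul_le_mul h1 h2 (by positivity) (by positivity)
  have h4 := factorial_sub_mul_pow_le hm
  have e : √(n : ℝ) ^ m * √(n : ℝ) ^ m = (n : ℝ) ^ m := by
    rw [← mul_pow, Real.mul_self_sqrt (Nat.cast_nonneg n)]
  rw [div_mul_eq_mul_div, le_div_iff₀ hpos]
  calc ((autMoving n T m).card : ℝ) * (autMoving n S m).card *
        ((n - m).factorial * √m ^ m) * √m ^ m
      = (n - m).factorial * (((autMoving n T m).card * √m ^ m) *
          ((autMoving n S m).card * √m ^ m)) := by ring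
    _ ≤ (n - m).factorial * (Real.exp m * √n ^ m * (Real.exp m * √n ^ m)) :=
        mul_le_mul_of_nonneg_left h3 (by positivity)
    _ = Real.exp m * Real.exp m * ((n - m).factorial * (n : ℝ) ^ m) := by rw [← e]; ring
    _ ≤ Real.exp m * Real.exp m * (Real.exp m * n.factorial) :=
        mul_le_mul_of_nonneg_left h4 (by positivity)
    _ = Real.exp (3 * m) * n.factorial := by
        rw [show (3 * m : ℝ) = m + m + m by ring, Real.exp_add, Real.exp_add]; ring

/-- The pairs of automorphisms of `T` and `S` compatible with the matching `v`. -/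
noncomputable def tangleAut (n : ℕ) (T S : PTree) (v : Equiv.Perm (Fin n)) :
    Finset (Equiv.Perm (Fin n) × Equiv.Perm (Fin n)) :=
  (isoPerms n T T ×ˢ isoPerms n S S).filter fun p => v * p.1 = p.2 * v

theorem sum_card_tangleAut_le {n : ℕ} (hn : 0 < n) {T S : PTree} (hT : T.size = n)
    (hS : S.size = n) :
    ∑ v : Equiv.Perm (Fin n), ((tangleAut n T S v).card : ℝ) ≤ autBound * n.factorial := by
  have h1 : ∑ v : Equiv.Perm (Fin n), ((tangleAut n T S v).card : ℝ) =
      ∑ p ∈ isoPerms n T T ×ˢ isoPerms n S S,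
        ((Finset.univ.filter fun v : Equiv.Perm (Fin n) => v * p.1 = p.2 * v).card : ℝ) := by
    simp only [tangleAut, Finset.card_filter, Nat.cast_sum]
    exact Finset.sum_comm
  have h2 : ∀ p ∈ isoPerms n T T ×ˢ isoPerms n S S,
      ((Finset.univ.filter fun v : Equiv.Perm (Fin n) => v * p.1 = p.2 * v).card : ℝ) ≤
        ∑ m ∈ Finset.range (n + 1), if p ∈ autMoving n T m ×ˢ autMoving n S m then
          ((n - m).factorial * √m ^ m : ℝ) else 0 := by
    intro p hp
    rw [Finset.mem_product] at hp
    by_cases hs : p.1.support.card = p.2.support.card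
    · have hle : p.1.support.card ≤ n := (Finset.card_le_univ _).trans_eq (Fintype.card_fin n)
      refine le_trans ?_ (Finset.single_le_sum (fun m _ => ?_)
        (Finset.mem_range.2 (Nat.lt_succ_of_le hle)))
      · rw [if_pos (by simp [autMoving, hp.1, hp.2, hs])]
        exact card_intertwining_le_real p.1 p.2 rfl hs.symm
      · split_ifs <;> positivity
    · rw [Finset.filter_false_of_mem fun v _ h => hs (card_support_eq_of_intertwining h)]
      simp only [Finset.card_empty, Nat.cast_zero]
      exact Finset.sum_nonneg fun m _ => by split_ifs <;> positivity
  rw [h1]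
  refine (Finset.sum_le_sum h2).trans ?_
  rw [Finset.sum_comm, autBound, ← tsum_mul_right]
  refine le_trans (Finset.sum_le_sum fun m hm => ?_)
    ((summable_exp_div_sqrt_pow.mul_right _).sum_le_tsum (Finset.range (n + 1))
      fun m _ => by positivity)
  refine le_trans (le_of_eq ?_) (autMoving_mul_intertwining_le hn
    (Nat.le_of_lt_succ (Finset.mem_range.1 hm)) hT hS)
  rw [← Finset.sum_filter, Finset.sum_const, nsmul_eq_mul, ← Nat.cast_mul, ← Finset.card_product]
  congr 3
  ext p
  simp only [autMoving, Finset.mem_filter, Finset.mem_product]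
  tauto

theorem autBound_pos : 0 < autBound :=
  summable_exp_div_sqrt_pow.tsum_pos (fun m => by positivity) 0 (by simp)

theorem planeTrees_nonempty {n : ℕ} (hn : 0 < n) : (planeTrees n).Nonempty := by
  induction n with
  | zero => omega
  | succ n ih =>
    rcases Nat.eq_zero_or_pos n with rfl | h
    · exact ⟨leaf, mem_planeTrees.2 rfl⟩
    · obtain ⟨T, hT⟩ := ih h
      exact ⟨node T leaf, mem_planeTrees.2 (by simp [size, mem_planeTrees.1 hT])⟩

/-- A matching as the list of its values. -/
def permList {n : ℕ} (v : Equiv.Perm (Fin n)) : List ℕ := List.ofFn fun i => (v i : ℕ)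

theorem getD_permList {n : ℕ} (v : Equiv.Perm (Fin n)) (i : Fin n) :
    (permList v).getD i 0 = v i := by
  simp [permList]

theorem permList_injective {n : ℕ} : Function.Injective (permList (n := n)) := by
  intro v w h
  refine Equiv.ext fun i => Fin.ext ?_
  rw [← getD_permList, h, getD_permList]

theorem mem_permutations_range {n : ℕ} {L : List ℕ} :
    L ∈ (List.range n).permutations.toFinset ↔ ∃ v : Equiv.Perm (Fin n), permList v = L := by
  rw [List.mem_toFinset, List.mem_permutations]
  constructor
  · intro h
    have hlen : L.length = n := by simpa using h.length_eq
    have hnd : L.Nodup := h.nodup_iff.2 List.nodup_range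
    subst hlen
    let F : Fin L.length → Fin L.length := fun i =>
      ⟨L[i], List.mem_range.1 (h.mem_iff.1 (List.getElem_mem i.2))⟩
    have hF : Function.Injective F := fun i j e =>
      Fin.ext ((hnd.getElem_inj_iff).1 (congrArg Fin.val e))
    exact ⟨Equiv.ofBijective F (Finite.injective_iff_bijective.1 hF), List.ofFn_getElem⟩
  · rintro ⟨v, rfl⟩
    have hnd : (permList v).Nodup :=
      List.nodup_ofFn.2 fun i j e => v.injective (Fin.ext e)
    refine (List.perm_ext_iff_of_nodup hnd List.nodup_range).2 fun k => ?_
    rw [permList, List.mem_ofFn, List.mem_range]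
    constructor
    · rintro ⟨i, rfl⟩
      exact (v i).2
    · intro hk
      exact ⟨v.symm ⟨k, hk⟩, by simp⟩

theorem sum_Triples {n : ℕ} (f : PTree × PTree × List ℕ → ℝ) :
    ∑ t ∈ Triples n, f t = ∑ T ∈ planeTrees n, ∑ S ∈ planeTrees n,
      ∑ v : Equiv.Perm (Fin n), f (T, S, permList v) := by
  have : (List.range n).permutations.toFinset =
      Finset.univ.image (permList (n := n)) := by
    ext L
    rw [mem_permutations_range]
    simp
  rw [Triples, Finset.sum_product, this]
  refine Finset.sum_congr rfl fun T _ => ?_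
  rw [Finset.sum_product]
  exact Finset.sum_congr rfl fun S _ => Finset.sum_image fun v _ w _ h => permList_injective h

theorem mem_Triples {n : ℕ} {t : PTree × PTree × List ℕ} :
    t ∈ Triples n ↔ t.1.size = n ∧ t.2.1.size = n ∧
      ∃ v : Equiv.Perm (Fin n), permList v = t.2.2 := by
  simp only [Triples, Finset.mem_product, mem_permutations_range, mem_planeTrees]

/-- The pairs of isomorphisms of the halves compatible with the matchings `v` and `v'`. -/
noncomputable def tangleIso (n : ℕ) (T S : PTree) (v : Equiv.Perm (Fin n)) (T' S' : PTree)
    (v' : Equiv.Perm (Fin n)) : Finset (Equiv.Perm (Fin n) × Equiv.Perm (Fin n)) :=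
  (isoPerms n T T' ×ˢ isoPerms n S S').filter fun p => v' * p.1 = p.2 * v

theorem mem_tangleIso {n : ℕ} {T S T' S' : PTree} {v v' σ τ : Equiv.Perm (Fin n)} :
    (σ, τ) ∈ tangleIso n T S v T' S' v' ↔
      (σ ∈ isoPerms n T T' ∧ τ ∈ isoPerms n S S') ∧ v' * σ = τ * v := by
  simp [tangleIso]

theorem equivTriple_permList_iff {n : ℕ} {T S T' S' : PTree} (hT : T.size = n) (hS : S.size = n)
    {v v' : Equiv.Perm (Fin n)} :
    equivTriple n (T, S, permList v) (T', S', permList v') = true ↔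
      (tangleIso n T S v T' S' v').Nonempty := by
  simp only [equivTriple, List.any_eq_true, List.all_eq_true, List.mem_range, beq_iff_eq]
  have compat : ∀ (f g : ℕ → ℕ) (σ τ : Equiv.Perm (Fin n)), (∀ i : Fin n, f i = σ i) →
      (∀ i : Fin n, g i = τ i) →
      ((∀ i < n, (permList v').getD (f i) 0 = g ((permList v).getD i 0)) ↔ v' * σ = τ * v) := by
    intro f g σ τ hf hg
    constructor
    · intro h
      refine Equiv.ext fun i => Fin.ext ?_
      have := h i i.2
      rwa [hf, getD_permList, getD_permList, hg] at this
    · intro h i hi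
      have := congrArg Fin.val (congrArg (fun w : Equiv.Perm (Fin n) => w ⟨i, hi⟩) h)
      rw [show i = ((⟨i, hi⟩ : Fin n) : ℕ) from rfl, hf, getD_permList, getD_permList, hg]
      exact this
  constructor
  · rintro ⟨f, hf, g, hg, h⟩
    obtain ⟨σ, hσ⟩ := exists_perm_of_mem_isoFuns hT hf
    obtain ⟨τ, hτ⟩ := exists_perm_of_mem_isoFuns hS hg
    exact ⟨(σ, τ), mem_tangleIso.2 ⟨⟨mem_isoPerms.2 ⟨f, hf, hσ⟩, mem_isoPerms.2 ⟨g, hg, hτ⟩⟩,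
      (compat f g σ τ hσ hτ).1 h⟩⟩
  · rintro ⟨⟨σ, τ⟩, h⟩
    obtain ⟨⟨hσ, hτ⟩, h⟩ := mem_tangleIso.1 h
    obtain ⟨f, hf, hf'⟩ := mem_isoPerms.1 hσ
    obtain ⟨g, hg, hg'⟩ := mem_isoPerms.1 hτ
    exact ⟨f, hf, g, hg, (compat f g σ τ hf' hg').2 h⟩

theorem equivTriple_refl {n : ℕ} {t : PTree × PTree × List ℕ} (ht : t ∈ Triples n) :
    equivTriple n t t = true := by
  obtain ⟨T, S, L⟩ := t
  obtain ⟨hT, hS, v, rfl⟩ := mem_Triples.1 ht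
  exact (equivTriple_permList_iff hT hS).2
    ⟨(1, 1), mem_tangleIso.2 ⟨⟨one_mem_isoPerms hT, one_mem_isoPerms hS⟩, by simp⟩⟩

theorem equivTriple_symm {n : ℕ} {t t' : PTree × PTree × List ℕ} (ht : t ∈ Triples n)
    (ht' : t' ∈ Triples n) (h : equivTriple n t t' = true) : equivTriple n t' t = true := by
  obtain ⟨T, S, L⟩ := t
  obtain ⟨T', S', L'⟩ := t'
  obtain ⟨hT, hS, v, rfl⟩ := mem_Triples.1 ht
  obtain ⟨hT', hS', v', rfl⟩ := mem_Triples.1 ht'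
  obtain ⟨⟨σ, τ⟩, h⟩ := (equivTriple_permList_iff hT hS).1 h
  obtain ⟨⟨hσ, hτ⟩, h⟩ := mem_tangleIso.1 h
  refine (equivTriple_permList_iff hT' hS').2 ⟨(σ⁻¹, τ⁻¹), mem_tangleIso.2
    ⟨⟨inv_mem_isoPerms hT hσ, inv_mem_isoPerms hS hτ⟩, ?_⟩⟩
  rw [mul_inv_eq_iff_eq_mul, mul_assoc, h, inv_mul_cancel_left]

theorem equivTriple_trans {n : ℕ} {t t' t'' : PTree × PTree × List ℕ} (ht : t ∈ Triples n)
    (ht' : t' ∈ Triples n) (ht'' : t'' ∈ Triples n) (h : equivTriple n t t' = true)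
    (h' : equivTriple n t' t'' = true) : equivTriple n t t'' = true := by
  obtain ⟨T, S, L⟩ := t
  obtain ⟨T', S', L'⟩ := t'
  obtain ⟨T'', S'', L''⟩ := t''
  obtain ⟨hT, hS, v, rfl⟩ := mem_Triples.1 ht
  obtain ⟨hT', hS', v', rfl⟩ := mem_Triples.1 ht'
  obtain ⟨hT'', hS'', v'', rfl⟩ := mem_Triples.1 ht''
  obtain ⟨⟨σ, τ⟩, h⟩ := (equivTriple_permList_iff hT hS).1 h
  obtain ⟨⟨hσ, hτ⟩, h⟩ := mem_tangleIso.1 h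
  obtain ⟨⟨σ', τ'⟩, h'⟩ := (equivTriple_permList_iff hT' hS').1 h'
  obtain ⟨⟨hσ', hτ'⟩, h'⟩ := mem_tangleIso.1 h'
  refine (equivTriple_permList_iff hT hS).2 ⟨(σ' * σ, τ' * τ), mem_tangleIso.2
    ⟨⟨mul_mem_isoPerms hT hσ hσ', mul_mem_isoPerms hS hτ hτ'⟩, ?_⟩⟩
  rw [← mul_assoc, h', mul_assoc, h, mul_assoc]

theorem card_tangleIso {n : ℕ} {T S T' S' : PTree} (hT : T.size = n) (hS : S.size = n)
    {v v' : Equiv.Perm (Fin n)} (h : (tangleIso n T S v T' S' v').Nonempty) :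
    (tangleIso n T S v T' S' v').card = (tangleAut n T S v).card := by
  obtain ⟨⟨σ, τ⟩, h⟩ := h
  obtain ⟨⟨hσ, hτ⟩, h⟩ := mem_tangleIso.1 h
  refine Finset.card_bij' (fun p _ => (σ⁻¹ * p.1, τ⁻¹ * p.2)) (fun p _ => (σ * p.1, τ * p.2))
    ?_ ?_ ?_ ?_
  · rintro ⟨σ', τ'⟩ hp
    obtain ⟨⟨hσ', hτ'⟩, h'⟩ := mem_tangleIso.1 hp
    refine mem_tangleIso.2 ⟨⟨mul_mem_isoPerms hT hσ' (inv_mem_isoPerms hT hσ),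
      mul_mem_isoPerms hS hτ' (inv_mem_isoPerms hS hτ)⟩, ?_⟩
    have e : v * σ⁻¹ = τ⁻¹ * v' := by
      rw [mul_inv_eq_iff_eq_mul, mul_assoc, h, inv_mul_cancel_left]
    rw [← mul_assoc, e, mul_assoc, h', mul_assoc]
  · rintro ⟨σ', τ'⟩ hp
    obtain ⟨⟨hσ', hτ'⟩, h'⟩ := mem_tangleIso.1 hp
    refine mem_tangleIso.2 ⟨⟨mul_mem_isoPerms hT hσ' hσ, mul_mem_isoPerms hS hτ' hτ⟩, ?_⟩
    rw [← mul_assoc, h, mul_assoc, h', mul_assoc]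
  · simp
  · simp

/-- The equivalence class of a triple. -/
def tangleClass (n : ℕ) (t : PTree × PTree × List ℕ) : Finset (PTree × PTree × List ℕ) :=
  (Triples n).filter fun t' => equivTriple n t t' = true

theorem mem_tangleClass {n : ℕ} {t t' : PTree × PTree × List ℕ} :
    t' ∈ tangleClass n t ↔ t' ∈ Triples n ∧ equivTriple n t t' = true :=
  Finset.mem_filter

theorem mem_tangleClasses {n : ℕ} {c : Finset (PTree × PTree × List ℕ)} :
    c ∈ tangleClasses n ↔ ∃ t ∈ Triples n, tangleClass n t = c := by
  simp [tangleClasses, tangleClass]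

theorem tangleClass_eq_iff {n : ℕ} {t t' : PTree × PTree × List ℕ} (ht : t ∈ Triples n)
    (ht' : t' ∈ Triples n) : tangleClass n t' = tangleClass n t ↔ t' ∈ tangleClass n t := by
  constructor
  · intro h
    rw [← h]
    exact mem_tangleClass.2 ⟨ht', equivTriple_refl ht'⟩
  · intro h
    have h := (mem_tangleClass.1 h).2
    ext u
    rw [mem_tangleClass, mem_tangleClass]
    exact and_congr_right fun hu => ⟨equivTriple_trans ht ht' hu h,
      equivTriple_trans ht' ht hu (equivTriple_symm ht ht' h)⟩

theorem sum_card_isoPerms {n : ℕ} {T : PTree} (hT : T.size = n) :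
    2 * ∑ T' ∈ planeTrees n, ((isoPerms n T T').card : ℝ) = 2 ^ n := by
  have := sum_length_isoFuns T
  rw [hT] at this
  simp only [card_isoPerms hT]
  exact_mod_cast this

theorem card_tangleClass_mul_card_tangleAut {n : ℕ} {T S : PTree} (hT : T.size = n)
    (hS : S.size = n) (v : Equiv.Perm (Fin n)) :
    4 * (((tangleClass n (T, S, permList v)).card : ℝ) * (tangleAut n T S v).card) = 4 ^ n := by
  have h1 : ∀ T' S' : PTree, ∑ v' : Equiv.Perm (Fin n),
      ((tangleIso n T S v T' S' v').card : ℝ) =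
        (isoPerms n T T').card * (isoPerms n S S').card := by
    intro T' S'
    rw [← Nat.cast_mul, ← Finset.card_product]
    simp only [tangleIso, Finset.card_filter, Nat.cast_sum]
    rw [Finset.sum_comm, Finset.card_eq_sum_ones, Nat.cast_sum]
    refine Finset.sum_congr rfl fun p _ => ?_
    simp [← eq_mul_inv_iff_mul_eq]
  have h2 : ((tangleClass n (T, S, permList v)).card : ℝ) * (tangleAut n T S v).card =
      ∑ T' ∈ planeTrees n, ∑ S' ∈ planeTrees n, ∑ v' : Equiv.Perm (Fin n),
        ((tangleIso n T S v T' S' v').card : ℝ) := by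
    rw [tangleClass, Finset.card_filter, Nat.cast_sum, Finset.sum_mul, sum_Triples]
    refine Finset.sum_congr rfl fun T' _ => Finset.sum_congr rfl fun S' _ =>
      Finset.sum_congr rfl fun v' _ => ?_
    by_cases h : (tangleIso n T S v T' S' v').Nonempty
    · rw [if_pos ((equivTriple_permList_iff hT hS).2 h), card_tangleIso hT hS h]; simp
    · rw [if_neg ((equivTriple_permList_iff hT hS).not.2 h), Finset.not_nonempty_iff_eq_empty.1 h]
      simp
  rw [h2]
  simp only [h1]
  rw [← Finset.sum_mul_sum]
  have e1 := sum_card_isoPerms hT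
  have e2 := sum_card_isoPerms hS
  calc _ = (2 * ∑ T' ∈ planeTrees n, ((isoPerms n T T').card : ℝ)) *
        (2 * ∑ S' ∈ planeTrees n, ((isoPerms n S S').card : ℝ)) := by ring
    _ = _ := by rw [e1, e2, ← mul_pow]; norm_num

theorem sum_tangleClasses {n : ℕ} (g : PTree → ℝ) (H : Finset (PTree × PTree × List ℕ) → ℝ)
    (hH : ∀ t ∈ Triples n, H (tangleClass n t) = g t.1) :
    ∑ c ∈ tangleClasses n, H c = 4 / 4 ^ n * ∑ T ∈ planeTrees n, g T *
      ∑ S ∈ planeTrees n, ∑ v : Equiv.Perm (Fin n), ((tangleAut n T S v).card : ℝ) := by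
  have h1 : ∑ t ∈ Triples n, g t.1 / (tangleClass n t).card = ∑ c ∈ tangleClasses n, H c := by
    rw [← Finset.sum_fiberwise_of_maps_to (t := tangleClasses n) (g := tangleClass n)
      fun t ht => mem_tangleClasses.2 ⟨t, ht, rfl⟩]
    refine Finset.sum_congr rfl fun c hc => ?_
    obtain ⟨t, ht, rfl⟩ := mem_tangleClasses.1 hc
    have hfib : (Triples n).filter (fun t' => tangleClass n t' = tangleClass n t) =
        tangleClass n t := by
      ext u
      rw [Finset.mem_filter]
      constructor
      · exact fun h => (tangleClass_eq_iff ht h.1).1 h.2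
      · exact fun h => ⟨(mem_tangleClass.1 h).1, (tangleClass_eq_iff ht (mem_tangleClass.1 h).1).2 h⟩
    rw [Finset.sum_congr rfl fun u hu => by
      rw [← hH u (Finset.mem_filter.1 hu).1, (Finset.mem_filter.1 hu).2], hfib, Finset.sum_const,
      nsmul_eq_mul]
    have : ((tangleClass n t).card : ℝ) ≠ 0 := by
      rw [Nat.cast_ne_zero, Finset.card_ne_zero]
      exact ⟨t, mem_tangleClass.2 ⟨ht, equivTriple_refl ht⟩⟩
    field_simp
  rw [← h1, sum_Triples, Finset.mul_sum]
  refine Finset.sum_congr rfl fun T hT => ?_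
  rw [← mul_assoc, Finset.mul_sum]
  refine Finset.sum_congr rfl fun S hS => ?_
  rw [Finset.mul_sum]
  refine Finset.sum_congr rfl fun v _ => ?_
  have h := card_tangleClass_mul_card_tangleAut (mem_planeTrees.1 hT) (mem_planeTrees.1 hS) v
  have h4 : (4 : ℝ) ^ n ≠ 0 := by positivity
  have h0 : ((tangleClass n (T, S, permList v)).card : ℝ) ≠ 0 := by
    intro h0
    rw [h0, zero_mul, mul_zero] at h
    exact h4 h.symm
  rw [div_mul_eq_mul_div, div_mul_eq_mul_div, div_eq_div_iff h0 h4, ← h]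
  ring

theorem factorial_le_sum_card_tangleAut {n : ℕ} {T S : PTree} (hT : T.size = n)
    (hS : S.size = n) :
    (n.factorial : ℝ) ≤ ∑ v : Equiv.Perm (Fin n), ((tangleAut n T S v).card : ℝ) := by
  have h : ∀ v ∈ (Finset.univ : Finset (Equiv.Perm (Fin n))),
      (1 : ℝ) ≤ ((tangleAut n T S v).card : ℝ) := by
    intro v _
    rw [Nat.one_le_cast, Nat.one_le_iff_ne_zero, Finset.card_ne_zero]
    exact ⟨(1, 1), mem_tangleIso.2 ⟨⟨one_mem_isoPerms hT, one_mem_isoPerms hS⟩, by simp⟩⟩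
  have := Finset.card_nsmul_le_sum _ _ _ h
  rwa [Finset.card_univ, Fintype.card_perm, Fintype.card_fin, nsmul_one] at this

theorem le_numTanglegrams (n : ℕ) :
    4 / 4 ^ n * ((planeTrees n).card ^ 2 * n.factorial : ℝ) ≤ numTanglegrams n := by
  have h := sum_tangleClasses (n := n) (fun _ => 1) (fun _ => 1) fun _ _ => rfl
  rw [Finset.sum_const, nsmul_one] at h
  rw [numTanglegrams, h]
  refine mul_le_mul_of_nonneg_left ?_ (by positivity)
  calc ((planeTrees n).card ^ 2 * n.factorial : ℝ) =
        ∑ _T ∈ planeTrees n, ∑ _S ∈ planeTrees n, (n.factorial : ℝ) := by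
        simp only [Finset.sum_const, nsmul_eq_mul]; ring
    _ ≤ _ := Finset.sum_le_sum fun T hT => by
        rw [one_mul]
        exact Finset.sum_le_sum fun S hS =>
          factorial_le_sum_card_tangleAut (mem_planeTrees.1 hT) (mem_planeTrees.1 hS)

theorem sum_tangleClasses_le {n : ℕ} (hn : 0 < n) (g : PTree → ℝ) (hg : ∀ T, 0 ≤ g T)
    (H : Finset (PTree × PTree × List ℕ) → ℝ)
    (hH : ∀ t ∈ Triples n, H (tangleClass n t) = g t.1) :
    ∑ c ∈ tangleClasses n, H c ≤ 4 / 4 ^ n * ((planeTrees n).card * n.factorial *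
      (autBound * ∑ T ∈ planeTrees n, g T)) := by
  rw [sum_tangleClasses g H hH]
  refine mul_le_mul_of_nonneg_left ?_ (by positivity)
  calc _ ≤ ∑ T ∈ planeTrees n, g T * ∑ _S ∈ planeTrees n, autBound * (n.factorial : ℝ) :=
        Finset.sum_le_sum fun T hT => mul_le_mul_of_nonneg_left (Finset.sum_le_sum fun S hS =>
          sum_card_tangleAut_le hn (mem_planeTrees.1 hT) (mem_planeTrees.1 hS)) (hg T)
    _ = _ := by
        rw [← Finset.sum_mul, Finset.sum_const, nsmul_eq_mul]; ring

theorem tangleExp_eq_sum {n : ℕ} (f : PTree × PTree × List ℕ → ℕ)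
    (H : Finset (PTree × PTree × List ℕ) → ℕ)
    (hH : ∀ c ∈ tangleClasses n, ∀ t ∈ c, f t = H c) :
    tangleExp n f = (∑ c ∈ tangleClasses n, (H c : ℝ)) / numTanglegrams n := by
  have hne : ∀ c ∈ tangleClasses n, c.Nonempty := by
    intro c hc
    obtain ⟨t, ht, rfl⟩ := mem_tangleClasses.1 hc
    exact ⟨t, mem_tangleClass.2 ⟨ht, equivTriple_refl ht⟩⟩
  have h1 : ∀ k : ℕ, ((tangleClasses n).filter fun c => ∃ t ∈ c, f t = k) =
      (tangleClasses n).filter fun c => H c = k := by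
    intro k
    refine Finset.filter_congr fun c hc => ?_
    constructor
    · rintro ⟨t, ht, rfl⟩
      exact (hH c hc t ht).symm
    · rintro rfl
      obtain ⟨t, ht⟩ := hne c hc
      exact ⟨t, ht, hH c hc t ht⟩
  simp only [tangleExp, tangleProb, h1]
  rw [tsum_eq_sum (s := (tangleClasses n).image H)]
  · simp only [← mul_div_assoc]
    rw [← Finset.sum_div, ← Finset.sum_fiberwise_of_maps_to (t := (tangleClasses n).image H)
      (g := H) fun c hc => Finset.mem_image_of_mem H hc]
    congr 1
    refine Finset.sum_congr rfl fun k _ => ?_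
    rw [Finset.sum_congr rfl fun c hc => by rw [(Finset.mem_filter.1 hc).2], Finset.sum_const,
      nsmul_eq_mul, mul_comm]
  · intro k hk
    rw [Finset.filter_false_of_mem fun c hc h => hk (Finset.mem_image.2 ⟨c, hc, h⟩)]
    simp

theorem sq_tangleExp_occ_sub_le {n : ℕ} (hn : 0 < n) (B : PTree) (μ : ℝ) :
    (tangleExp n (fun t => occ B t.1) / n - μ) ^ 2 ≤
      autBound * ((∑ T ∈ planeTrees n, ((occ B T : ℝ) / n - μ) ^ 2) / (planeTrees n).card) := by
  have inv : ∀ t ∈ Triples n, ∀ u ∈ tangleClass n t, occ B u.1 = occ B t.1 := by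
    intro t _ u hu
    have h := (mem_tangleClass.1 hu).2
    rw [equivTriple, List.any_eq_true] at h
    obtain ⟨f, hf, -⟩ := h
    exact (normalize_eq_and_occ_eq_of_mem_isoFuns B hf).2.symm
  let H : Finset (PTree × PTree × List ℕ) → ℕ := fun c =>
    if h : c.Nonempty then occ B h.choose.1 else 0
  have hHt : ∀ t ∈ Triples n, H (tangleClass n t) = occ B t.1 := by
    intro t ht
    have hne : (tangleClass n t).Nonempty := ⟨t, mem_tangleClass.2 ⟨ht, equivTriple_refl ht⟩⟩
    simp only [H, dif_pos hne]
    exact inv t ht _ hne.choose_spec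
  have hP : 0 < ((planeTrees n).card : ℝ) := by
    exact_mod_cast (planeTrees_nonempty hn).card_pos
  have hlow := le_numTanglegrams n
  have hN : 0 < (numTanglegrams n : ℝ) := lt_of_lt_of_le (by positivity) hlow
  have hn' : (n : ℝ) ≠ 0 := by exact_mod_cast hn.ne'
  have hE : tangleExp n (fun t => occ B t.1) / n - μ =
      (∑ c ∈ tangleClasses n, ((H c : ℝ) / n - μ)) / numTanglegrams n := by
    rw [tangleExp_eq_sum _ H, Finset.sum_sub_distrib, ← Finset.sum_div, Finset.sum_const,
      nsmul_eq_mul]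
    · rw [show ((tangleClasses n).card : ℝ) = numTanglegrams n from rfl]
      field_simp
    · intro c hc t htc
      obtain ⟨u, hu, rfl⟩ := mem_tangleClasses.1 hc
      rw [hHt u hu, inv u hu t htc]
  have hup := sum_tangleClasses_le hn (fun T => ((occ B T : ℝ) / n - μ) ^ 2)
    (fun T => sq_nonneg _) (fun c => ((H c : ℝ) / n - μ) ^ 2)
    (fun t ht => by simp only [hHt t ht])
  have hcs : (∑ c ∈ tangleClasses n, ((H c : ℝ) / n - μ)) ^ 2 ≤
      numTanglegrams n * ∑ c ∈ tangleClasses n, ((H c : ℝ) / n - μ) ^ 2 :=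
    sq_sum_le_card_mul_sum_sq
  set V := ∑ T ∈ planeTrees n, ((occ B T : ℝ) / n - μ) ^ 2
  have hV : 0 ≤ V := Finset.sum_nonneg fun T _ => sq_nonneg _
  rw [hE, div_pow, div_le_iff₀ (by positivity)]
  calc _ ≤ _ := hcs
    _ ≤ numTanglegrams n * (4 / 4 ^ n * ((planeTrees n).card * n.factorial * (autBound * V))) :=
        mul_le_mul_of_nonneg_left hup hN.le
    _ = autBound * (V / (planeTrees n).card) *
          (numTanglegrams n * (4 / 4 ^ n * ((planeTrees n).card ^ 2 * n.factorial))) := by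
        field_simp
    _ ≤ autBound * (V / (planeTrees n).card) * (numTanglegrams n * numTanglegrams n) := by
        have := autBound_pos
        gcongr
    _ = _ := by ring

theorem occ_eq_zero_of_size_lt {B T : PTree} (h : T.size < B.size) : occ B T = 0 := by
  have key : ∀ T : PTree, T.size < B.size → normalize T ≠ normalize B := fun T h e =>
    h.ne (size_eq_of_normalize_eq e)
  induction T with
  | leaf => simp [occ, key _ h]
  | node l r ihl ihr =>
    have h' := h
    simp only [size] at h'
    simp [occ, key _ h, ihl (by omega), ihr (by omega)]

/-- The indicator that a tree is isomorphic to `B`. -/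
noncomputable def isoInd (B T : PTree) : ℝ := if normalize T = normalize B then 1 else 0

theorem occ_leaf_cast (B : PTree) : (occ B leaf : ℝ) = isoInd B leaf := by
  simp [occ, isoInd]

theorem occ_node_cast (B l r : PTree) :
    (occ B (node l r) : ℝ) = isoInd B (node l r) + (occ B l + occ B r) := by
  simp [occ, isoInd, add_assoc]

theorem sum_isoInd (B : PTree) (n : ℕ) :
    ∑ T ∈ planeTrees n, isoInd B T = if n = B.size then (numPlane B : ℝ) else 0 := by
  split_ifs with h
  · subst h
    simp [isoInd, numPlane]
  · refine Finset.sum_eq_zero fun T hT => if_neg fun e => h ?_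
    rw [← mem_planeTrees.1 hT, size_eq_of_normalize_eq e]

theorem isoInd_node_mul_occ (B l r : PTree) :
    isoInd B (node l r) * ((occ B l : ℝ) + occ B r) = 0 := by
  by_cases h : normalize (node l r) = normalize B
  · have hs := size_eq_of_normalize_eq h
    have hl := size_pos l
    have hr := size_pos r
    simp only [size] at hs
    rw [occ_eq_zero_of_size_lt (T := l) (by omega), occ_eq_zero_of_size_lt (T := r) (by omega)]
    simp
  · simp [isoInd, h]

section GeneratingSeries

open PowerSeries

/-- The generating series of plane trees by size, weighted by the `j`-th power of the number of
occurrences of `B`. -/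
noncomputable def occSeries (B : PTree) (j : ℕ) : ℝ⟦X⟧ :=
  PowerSeries.mk fun n => ∑ T ∈ planeTrees n, (occ B T : ℝ) ^ j

theorem coeff_occSeries_mul (B : PTree) (i j n : ℕ) :
    coeff n (occSeries B i * occSeries B j) =
      ∑ p ∈ Finset.HasAntidiagonal.antidiagonal n, ∑ l ∈ planeTrees p.1, ∑ r ∈ planeTrees p.2,
        (occ B l : ℝ) ^ i * (occ B r : ℝ) ^ j := by
  simp only [coeff_mul, occSeries, coeff_mk, Finset.sum_mul_sum]

theorem occSeries_zero (B : PTree) : occSeries B 0 = X + occSeries B 0 * occSeries B 0 := by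
  ext n
  rw [map_add, coeff_occSeries_mul, coeff_X, occSeries, coeff_mk, sum_planeTrees']
  simp

theorem occSeries_one (B : PTree) : occSeries B 1 =
    C (numPlane B : ℝ) * X ^ B.size + 2 * (occSeries B 0 * occSeries B 1) := by
  ext n
  have h := sum_planeTrees' (fun T => (occ B T : ℝ) - isoInd B T) n
  rw [Finset.sum_sub_distrib, sum_isoInd] at h
  simp only [occ_leaf_cast, occ_node_cast, sub_self, ite_self, zero_add, add_sub_cancel_left] at h
  have h2 : coeff n (2 * (occSeries B 0 * occSeries B 1)) =
      coeff n (occSeries B 1 * occSeries B 0) + coeff n (occSeries B 0 * occSeries B 1) := by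
    rw [← map_add]; congr 1; ring
  rw [map_add, h2, coeff_occSeries_mul, coeff_occSeries_mul, coeff_C_mul, coeff_X_pow, occSeries,
    coeff_mk]
  simp only [pow_one, pow_zero, mul_one, one_mul, mul_ite, mul_zero]
  simp only [Finset.sum_add_distrib] at h ⊢
  linarith

theorem occSeries_two (B : PTree) : occSeries B 2 =
    C (numPlane B : ℝ) * X ^ B.size + 2 * (occSeries B 0 * occSeries B 2) +
      2 * (occSeries B 1 * occSeries B 1) := by
  ext n
  have h := sum_planeTrees' (fun T => (occ B T : ℝ) ^ 2 - isoInd B T) n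
  have hsq : ∀ T, isoInd B T ^ 2 = isoInd B T := fun T => by
    unfold isoInd; split_ifs <;> simp
  have hnode : ∀ l r, (occ B (node l r) : ℝ) ^ 2 - isoInd B (node l r) =
      (occ B l : ℝ) ^ 2 + (occ B r : ℝ) ^ 2 + (occ B l * occ B r + occ B l * occ B r) := by
    intro l r
    rw [occ_node_cast]
    linear_combination hsq (node l r) + 2 * isoInd_node_mul_occ B l r
  rw [Finset.sum_sub_distrib, sum_isoInd] at h
  simp only [occ_leaf_cast, hsq, hnode, sub_self, ite_self, zero_add] at h
  have h2 : coeff n (2 * (occSeries B 0 * occSeries B 2)) =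
      coeff n (occSeries B 2 * occSeries B 0) + coeff n (occSeries B 0 * occSeries B 2) := by
    rw [← map_add]; congr 1; ring
  have h3 : coeff n (2 * (occSeries B 1 * occSeries B 1)) =
      coeff n (occSeries B 1 * occSeries B 1) + coeff n (occSeries B 1 * occSeries B 1) := by
    rw [← map_add]; congr 1; ring
  rw [map_add, map_add, h2, h3, coeff_occSeries_mul, coeff_occSeries_mul, coeff_occSeries_mul,
    coeff_C_mul, coeff_X_pow, occSeries, coeff_mk]
  simp only [pow_one, pow_zero, mul_one, one_mul, mul_ite, mul_zero]
  simp only [Finset.sum_add_distrib] at h ⊢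
  linarith

/-- The series `1 / (1 - 2 A)`, where `A` is the generating series of plane trees. -/
noncomputable def invSeries : ℝ⟦X⟧ := (1 - 2 * occSeries leaf 0)⁻¹

theorem occSeries_zero_eq (B : PTree) : occSeries B 0 = occSeries leaf 0 := by
  simp [occSeries]

theorem mul_invSeries (B : PTree) : (1 - 2 * occSeries B 0) * invSeries = 1 := by
  rw [occSeries_zero_eq]
  refine PowerSeries.mul_inv_cancel _ ?_
  rw [map_sub, map_mul, ← coeff_zero_eq_constantCoeff_apply (occSeries leaf 0)]
  simp [occSeries, planeTrees]

theorem invSeries_sq_mul : invSeries ^ 2 * (1 - 4 * X) = 1 := by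
  have h1 := mul_invSeries leaf
  have h2 := occSeries_zero leaf
  have : (1 - 4 * X : ℝ⟦X⟧) = (1 - 2 * occSeries leaf 0) ^ 2 := by
    linear_combination 4 * h2
  rw [this, ← mul_pow, mul_comm, h1, one_pow]

theorem derivative_invSeries : derivative ℝ invSeries = 2 * invSeries ^ 3 := by
  have h1 := invSeries_sq_mul
  have h := congrArg (derivative ℝ) h1
  have h4 : derivative ℝ (4 : ℝ⟦X⟧) = 0 := by
    simpa using (derivative ℝ).map_natCast 4
  simp only [Derivation.leibniz, Derivation.leibniz_pow, map_sub, Derivation.map_one_eq_zero,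
    derivative_X, h4, smul_eq_mul, nsmul_eq_mul, Nat.cast_ofNat] at h
  have h5 : 2 * invSeries * (1 - 4 * X) * (derivative ℝ invSeries - 2 * invSeries ^ 3) = 0 := by
    simp only [Nat.add_one_sub_one, pow_one] at h
    linear_combination h - 4 * invSeries ^ 2 * h1
  have h6 : (2 : ℝ⟦X⟧) * (derivative ℝ invSeries - 2 * invSeries ^ 3) = 0 := by
    linear_combination invSeries * h5 - 2 * (derivative ℝ invSeries - 2 * invSeries ^ 3) * h1
  have h2 : (2 : ℝ⟦X⟧) ≠ 0 := fun h0 => by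
    have h0' := congrArg (constantCoeff (R := ℝ)) h0
    rw [map_ofNat, map_zero] at h0'
    exact two_ne_zero h0'
  exact sub_eq_zero.1 ((mul_eq_zero.1 h6).resolve_left h2)

theorem coeff_natCast_mul (k : ℕ) (f : ℝ⟦X⟧) (n : ℕ) :
    coeff n ((k : ℝ⟦X⟧) * f) = k * coeff n f := by
  rw [← map_natCast (C (R := ℝ)), coeff_C_mul]

theorem coeff_invSeries_pow_three (n : ℕ) :
    2 * coeff n (invSeries ^ 3) = (n + 1) * coeff (n + 1) invSeries := by
  have h := congrArg (coeff n) derivative_invSeries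
  rw [coeff_derivative, show (2 : ℝ⟦X⟧) = ((2 : ℕ) : ℝ⟦X⟧) by simp,
    coeff_natCast_mul] at h
  push_cast at h
  linarith

theorem coeff_invSeries_succ (n : ℕ) :
    (n + 1) * coeff (n + 1) invSeries = (4 * n + 2) * coeff n invSeries := by
  have h : derivative ℝ invSeries = ((2 : ℕ) : ℝ⟦X⟧) * invSeries +
      ((4 : ℕ) : ℝ⟦X⟧) * (X * derivative ℝ invSeries) := by
    push_cast
    rw [derivative_invSeries]
    linear_combination 2 * invSeries * invSeries_sq_mul
  have h' := congrArg (coeff n) h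
  rw [map_add, coeff_natCast_mul, coeff_natCast_mul, coeff_derivative] at h'
  have hX : coeff n (X * derivative ℝ invSeries) = n * coeff n invSeries := by
    cases n with
    | zero => simp
    | succ n => rw [coeff_succ_X_mul, coeff_derivative]; push_cast; ring
  rw [hX] at h'
  push_cast at h'
  linarith

theorem coeff_zero_invSeries : coeff 0 invSeries = 1 := by
  have h := congrArg (coeff 0) (mul_invSeries leaf)
  rw [coeff_mul] at h
  simpa [occSeries, planeTrees] using h

theorem coeff_invSeries_pos (n : ℕ) : 0 < coeff n invSeries := by
  induction n with
  | zero => rw [coeff_zero_invSeries]; exact one_pos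
  | succ n ih =>
    have h := coeff_invSeries_succ n
    have : 0 < (n + 1 : ℝ) * coeff (n + 1) invSeries := by rw [h]; positivity
    exact pos_of_mul_pos_right this (by positivity)

theorem card_planeTrees_succ (n : ℕ) :
    (n + 1) * ((planeTrees (n + 1)).card : ℝ) = coeff n invSeries := by
  have h : ((2 : ℕ) : ℝ⟦X⟧) * occSeries leaf 0 + invSeries =
      1 + ((4 : ℕ) : ℝ⟦X⟧) * (X * invSeries) := by
    push_cast
    linear_combination (1 - 2 * occSeries leaf 0) * invSeries_sq_mul -
      invSeries * (1 - 4 * X) * mul_invSeries leaf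
  have h' := congrArg (coeff (n + 1)) h
  rw [map_add, map_add, coeff_natCast_mul, coeff_natCast_mul,
    coeff_succ_X_mul, coeff_one, if_neg (by omega), occSeries, coeff_mk] at h'
  simp only [pow_zero, Finset.sum_const, nsmul_eq_mul, mul_one] at h'
  push_cast at h'
  linear_combination (n + 1) / 2 * h' - coeff_invSeries_succ n / 2

theorem occSeries_one_eq (B : PTree) :
    occSeries B 1 = C (numPlane B : ℝ) * (X ^ B.size * invSeries) := by
  linear_combination invSeries * occSeries_one B - occSeries B 1 * mul_invSeries B

theorem occSeries_two_eq (B : PTree) :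
    occSeries B 2 = C (numPlane B : ℝ) * (X ^ B.size * invSeries) +
      ((2 : ℕ) : ℝ⟦X⟧) * (C ((numPlane B : ℝ) ^ 2) * (X ^ (2 * B.size) * invSeries ^ 3)) := by
  have h1 := occSeries_two B
  rw [occSeries_one_eq] at h1
  rw [map_pow]
  push_cast
  rw [two_mul B.size, pow_add]
  linear_combination invSeries * h1 - occSeries B 2 * mul_invSeries B

theorem sum_occ (B : PTree) (m : ℕ) :
    ∑ T ∈ planeTrees (m + B.size), (occ B T : ℝ) = numPlane B * coeff m invSeries := by
  have h := congrArg (coeff (m + B.size)) (occSeries_one_eq B)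
  rw [coeff_C_mul, coeff_X_pow_mul, occSeries, coeff_mk] at h
  simpa using h

theorem sum_occ_sq (B : PTree) (m : ℕ) :
    ∑ T ∈ planeTrees (m + 2 * B.size), (occ B T : ℝ) ^ 2 =
      numPlane B * coeff (m + B.size) invSeries +
        2 * ((numPlane B : ℝ) ^ 2 * ((2 * m + 1) * coeff m invSeries)) := by
  have h := congrArg (coeff (m + 2 * B.size)) (occSeries_two_eq B)
  rw [map_add, coeff_natCast_mul, coeff_C_mul, coeff_C_mul, coeff_X_pow_mul,
    show m + 2 * B.size = m + B.size + B.size by ring, coeff_X_pow_mul, occSeries, coeff_mk] at h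
  rw [show m + 2 * B.size = m + B.size + B.size by ring, h]
  have e1 := coeff_invSeries_pow_three m
  have e2 := coeff_invSeries_succ m
  push_cast
  linear_combination (numPlane B : ℝ) ^ 2 * (e1 + e2)

theorem tendsto_coeff_invSeries_ratio (j : ℕ) :
    Filter.Tendsto (fun m : ℕ => coeff (m + j) invSeries / coeff m invSeries) Filter.atTop
      (nhds (4 ^ j)) := by
  induction j with
  | zero =>
    simp only [add_zero, pow_zero]
    exact tendsto_const_nhds.congr fun m => (div_self (coeff_invSeries_pos m).ne').symm
  | succ j ih =>
    have h1 : Filter.Tendsto (fun m : ℕ => (4 : ℝ) - 2 * (1 / ((m : ℝ) + 1))) Filter.atTop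
        (nhds (4 - 2 * 0)) :=
      tendsto_const_nhds.sub (tendsto_one_div_add_atTop_nhds_zero_nat.const_mul 2)
    have h2 := (h1.comp (Filter.tendsto_add_atTop_nat j)).mul ih
    rw [mul_zero, sub_zero, ← pow_succ'] at h2
    refine h2.congr fun m => ?_
    have hp := (coeff_invSeries_pos m).ne'
    have hs := coeff_invSeries_succ (m + j)
    have hm : ((m + j : ℕ) : ℝ) + 1 ≠ 0 := by positivity
    rw [Function.comp_apply, ← mul_div_assoc, ← add_assoc]
    congr 1
    field_simp
    linear_combination -hs

theorem tendsto_variance (B : PTree) :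
    Filter.Tendsto (fun n : ℕ => (∑ T ∈ planeTrees n, ((occ B T : ℝ) / n - muB B) ^ 2) /
      (planeTrees n).card) Filter.atTop (nhds 0) := by
  obtain ⟨k, hk⟩ : ∃ k, B.size = k + 1 := ⟨B.size - 1, by have := size_pos B; omega⟩
  set N : ℝ := (numPlane B : ℝ) with hN
  have hmu : muB B = 4 * N / 4 ^ B.size := by
    have h : 2 * (N * (isoFuns B B).length) = 2 ^ B.size := by
      rw [hN]
      exact_mod_cast two_mul_numPlane_mul_length B
    have h2 : (0 : ℝ) < 2 ^ B.size := by positivity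
    have hl : ((isoFuns B B).length : ℝ) ≠ 0 := by
      intro h0
      rw [h0, mul_zero, mul_zero] at h
      exact h2.ne h
    rw [muB, show (4 : ℝ) ^ B.size = 2 ^ B.size * 2 ^ B.size by rw [← mul_pow]; norm_num,
      div_eq_div_iff (by positivity) (by positivity)]
    linear_combination -2 * 2 ^ B.size * h
  rw [← Filter.tendsto_add_atTop_iff_nat (2 * B.size)]
  have r1 := tendsto_coeff_invSeries_ratio B.size
  have r2 := tendsto_coeff_invSeries_ratio (2 * k + 1)
  have hinv : Filter.Tendsto (fun m : ℕ => 1 / ((m + 2 * B.size : ℕ) : ℝ)) Filter.atTop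
      (nhds 0) :=
    tendsto_one_div_atTop_nhds_zero_nat.comp (Filter.tendsto_add_atTop_nat (2 * B.size))
  have q1 : Filter.Tendsto (fun m : ℕ => N * (coeff (m + B.size) invSeries / coeff m invSeries /
      (coeff (m + (2 * k + 1)) invSeries / coeff m invSeries))) Filter.atTop (nhds (muB B)) := by
    have := (r1.div r2 (by positivity)).const_mul N
    convert this using 2
    · rfl
    rw [hmu, hk, show 2 * k + 1 = k + (k + 1) by ring, pow_add, pow_succ]
    field_simp
    ring
  have q2 : Filter.Tendsto (fun m : ℕ => 2 * N ^ 2 * (2 - (4 * B.size - 1) *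
      (1 / ((m + 2 * B.size : ℕ) : ℝ))) / (coeff (m + (2 * k + 1)) invSeries / coeff m invSeries))
      Filter.atTop (nhds (muB B ^ 2)) := by
    have := (((tendsto_const_nhds (x := (2 : ℝ))).sub
      (hinv.const_mul (4 * (B.size : ℝ) - 1))).const_mul (2 * N ^ 2)).div r2 (by positivity)
    convert this using 2
    · rfl
    rw [hmu, hk, mul_zero, sub_zero, show 2 * k + 1 = k + (k + 1) by ring, pow_add, pow_succ]
    field_simp
    ring
  have lim := (((q1.mul hinv).add q2).sub (q1.const_mul (2 * muB B))).add_const (muB B ^ 2)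
  rw [show muB B * 0 + muB B ^ 2 - 2 * muB B * muB B + muB B ^ 2 = 0 by ring] at lim
  refine lim.congr fun m => ?_
  have s0 := card_planeTrees_succ (m + (2 * k + 1))
  have s1 := sum_occ B (m + B.size)
  have s2 := sum_occ_sq B m
  rw [show m + B.size + B.size = m + 2 * B.size by ring] at s1
  rw [show m + (2 * k + 1) + 1 = m + 2 * B.size by rw [hk]; ring] at s0
  have hcast : ((m + (2 * k + 1) : ℕ) : ℝ) + 1 = ((m + 2 * B.size : ℕ) : ℝ) := by
    rw [hk]; push_cast; ring
  rw [hcast] at s0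
  have hn : ((m + 2 * B.size : ℕ) : ℝ) ≠ 0 := by rw [Nat.cast_ne_zero]; omega
  have hm : (2 * (m : ℝ) + 1) =
      2 * ((m + 2 * B.size : ℕ) : ℝ) - (4 * B.size - 1) := by push_cast; ring
  rw [hm] at s2
  have p0 := (coeff_invSeries_pos m).ne'
  have p1 := (coeff_invSeries_pos (m + (2 * k + 1))).ne'
  set n : ℕ := m + 2 * B.size
  have hP : ((planeTrees n).card : ℝ) ≠ 0 := by
    intro h0
    rw [h0, mul_zero] at s0
    exact p1 s0.symm
  have expand : ∑ T ∈ planeTrees n, ((occ B T : ℝ) / n - muB B) ^ 2 =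
      (∑ T ∈ planeTrees n, (occ B T : ℝ) ^ 2) / n ^ 2 -
        2 * muB B * (∑ T ∈ planeTrees n, (occ B T : ℝ)) / n +
          (planeTrees n).card * muB B ^ 2 := by
    rw [Finset.sum_div, Finset.mul_sum, Finset.sum_div, ← Finset.sum_sub_distrib,
      ← nsmul_eq_mul, ← Finset.sum_const, ← Finset.sum_add_distrib]
    refine Finset.sum_congr rfl fun T _ => ?_
    ring
  rw [expand, s1, s2, ← s0, ← hN]
  field_simp

end GeneratingSeries

theorem tendsto_tangleExp_occ_div (B : PTree) :
    Filter.Tendsto (fun n : ℕ => tangleExp n (fun t => occ B t.1) / n)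
      Filter.atTop (nhds (muB B)) := by
  have hlim := (tendsto_variance B).const_mul autBound
  rw [mul_zero] at hlim
  have hsq : Filter.Tendsto
      (fun n : ℕ => (tangleExp n (fun t => occ B t.1) / n - muB B) ^ 2) Filter.atTop (nhds 0) :=
    squeeze_zero' (Filter.Eventually.of_forall fun n => sq_nonneg _)
      ((Filter.eventually_gt_atTop 0).mono fun n hn => sq_tangleExp_occ_sub_le hn B (muB B)) hlim
  have habs := hsq.sqrt
  simp only [Real.sqrt_sq_eq_abs, Real.sqrt_zero] at habs
  exact tendsto_sub_nhds_zero_iff.1 ((tendsto_zero_iff_abs_tendsto_zero _).2 habs)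

theorem muB_cherry : muB (node leaf leaf) = 1 / 4 := by
  simp [muB, size, isoFuns]
  norm_num

/-- Corollary 4 (mean): the average number of occurrences of a fixed binary tree `B`
as a fringe subtree in the left tree of a random tanglegram of size `n` is
asymptotically `μ_B · n` with `μ_B = 2^(1-|B|)/|A(B)|`; in particular the average
number of cherries is asymptotically `n/4`. -/
theorem mean_occurrences :
    (∀ B : PTree, Filter.Tendsto
      (fun n : ℕ => tangleExp n (fun t => occ B t.1) / n)
      Filter.atTop (nhds (muB B))) ∧
    Filter.Tendsto
      (fun n : ℕ => tangleExp n (fun t => occ (node leaf leaf) t.1) / n)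
      Filter.atTop (nhds (1 / 4)) := by
  refine ⟨tendsto_tangleExp_occ_div, ?_⟩
  rw [← muB_cherry]
  exact tendsto_tangleExp_occ_div _

end PTree
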